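/- arXiv:2506.08858 — 11 statements merged into one kernel-verified Lean document; each statement's English description precedes it below -/
import Mathlib

section
/- Let q : L → M be a lattice quotient of finite lattices L and M. Then whenever x ⋖ z is a covering relation in L, either q(x) ⋖ q(z) is a covering relation in M or q(x) = q(z). -/
/-! Generic order-theoretic definitions: covering relations, intervals, maximal
chains in subposets, polygons, polygon/square moves, square-equivalence,
ascending chains with respect to an edge labelling, increasing polygon moves,
and the induced preorder on (square-equivalence classes of) maximal chains. -/

section GenericOrder

variable {α : Type*}

/-- `b` covers `a` with respect to the relation `r`. -/
def CovR (r : α → α → Prop) (a b : α) : Prop :=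
  r a b ∧ a ≠ b ∧ ∀ z, r a z → r z b → z = a ∨ z = b

/-- The closed interval from `x` to `y` with respect to `r`. -/
def IccR (r : α → α → Prop) (x y : α) : Set α := {z | r x z ∧ r z y}

/-- `C` is a maximal chain of the subposet `S` (with respect to `r`). -/
def MaxChainIn (r : α → α → Prop) (S C : Set α) : Prop :=
  C ⊆ S ∧ IsChain r C ∧ ∀ C' : Set α, C' ⊆ S → IsChain r C' → C ⊆ C' → C = C'

/-- `(x, y, C₁, C₂)` form a polygon: the interval `[x, y]` has exactly the two
distinct maximal chains `C₁ ≠ C₂`, whose union is the interval and whose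
intersection is `{x, y}`. -/
def IsPolygonPair (r : α → α → Prop) (x y : α) (C₁ C₂ : Set α) : Prop :=
  r x y ∧ MaxChainIn r (IccR r x y) C₁ ∧ MaxChainIn r (IccR r x y) C₂ ∧
    C₁ ≠ C₂ ∧ IccR r x y = C₁ ∪ C₂ ∧ C₁ ∩ C₂ = {x, y} ∧
    ∀ C : Set α, MaxChainIn r (IccR r x y) C → C = C₁ ∨ C = C₂

/-- `P` is a polygon with respect to `r`. -/
def IsPolygon (r : α → α → Prop) (P : Set α) : Prop :=
  ∃ x y C₁ C₂, P = IccR r x y ∧ IsPolygonPair r x y C₁ C₂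

/-- `C` and `C'` are related by a polygon move. -/
def PolygonMove (r : α → α → Prop) (C C' : Set α) : Prop :=
  ∃ x y P₁ P₂, IsPolygonPair r x y P₁ P₂ ∧ P₁ ⊆ C ∧ P₂ ⊆ C' ∧ C \ P₁ = C' \ P₂

/-- `C` and `C'` are related by a square move: a polygon move across a
four-element polygon. -/
def SquareMove (r : α → α → Prop) (C C' : Set α) : Prop :=
  ∃ x y P₁ P₂, IsPolygonPair r x y P₁ P₂ ∧ (IccR r x y).ncard = 4 ∧
    P₁ ⊆ C ∧ P₂ ⊆ C' ∧ C \ P₁ = C' \ P₂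

/-- Square-equivalence: the reflexive-transitive closure of square moves. -/
def SqEquiv (r : α → α → Prop) : Set α → Set α → Prop :=
  Relation.ReflTransGen (SquareMove r)

/-- The chain `C` has strictly increasing edge labels (with respect to the
strict order `lt` on labels): for any two covering pairs occurring along `C`,
the earlier one has strictly smaller label. -/
def ChainAscending {E : Type*} (r : α → α → Prop) (lab : α → α → E)
    (lt : E → E → Prop) (C : Set α) : Prop :=
  ∀ a b c d, a ∈ C → b ∈ C → c ∈ C → d ∈ C →
    CovR r a b → CovR r c d → r b c → lt (lab a b) (lab c d)

/-- `C'` is an increasing polygon move of `C`: they differ by a polygon move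
across a non-square polygon, with `C` containing the ascending chain. -/
def IncPolygonMove {E : Type*} (r : α → α → Prop) (lab : α → α → E)
    (lt : E → E → Prop) (C C' : Set α) : Prop :=
  ∃ x y P₁ P₂, IsPolygonPair r x y P₁ P₂ ∧ (IccR r x y).ncard ≠ 4 ∧
    P₁ ⊆ C ∧ P₂ ⊆ C' ∧ C \ P₁ = C' \ P₂ ∧ ChainAscending r lab lt P₁

/-- The preorder `≼` on (square-equivalence classes of) maximal chains: the
smallest preorder generated by square moves and increasing polygon moves. -/
def MGPre {E : Type*} (r : α → α → Prop) (lab : α → α → E) (lt : E → E → Prop) :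
    Set α → Set α → Prop :=
  Relation.ReflTransGen (fun A B => SqEquiv r A B ∨ IncPolygonMove r lab lt A B)

/-- `[C'] covers [C]` in the preorder `≼` on square-equivalence classes of
maximal chains: `[C] ≺ [C']` and every class weakly between them equals `[C]`
or `[C']`. -/
def MGCover {E : Type*} (r : α → α → Prop) (lab : α → α → E) (lt : E → E → Prop)
    (C C' : Set α) : Prop :=
  MGPre r lab lt C C' ∧ ¬ MGPre r lab lt C' C ∧
    ∀ D : Set α, IsMaxChain r D → MGPre r lab lt C D → MGPre r lab lt D C' →
      SqEquiv r D C ∨ SqEquiv r D C'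

/-- The labelling is polygon-complete: increasing polygon moves always give
covering relations of the preorder on square-equivalence classes. -/
def PolygonComplete {E : Type*} (r : α → α → Prop) (lab : α → α → E)
    (lt : E → E → Prop) : Prop :=
  ∀ C C' : Set α, IsMaxChain r C → IsMaxChain r C' → IncPolygonMove r lab lt C C' →
    MGCover r lab lt C C'

end GenericOrder

/-- Let `q : L → M` be a lattice quotient (a surjective map preserving joins and
meets) of finite lattices.  Whenever `x ⋖ z` is a covering relation of `L`,
either `q x ⋖ q z` is a covering relation of `M` or `q x = q z`. -/
theorem lattice_quotient_cover_or_eq {L M : Type*} [Lattice L] [Lattice M]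
    [Finite L] [Finite M]
    (q : L → M) (hsurj : Function.Surjective q)
    (hsup : ∀ x y : L, q (x ⊔ y) = q x ⊔ q y)
    (hinf : ∀ x y : L, q (x ⊓ y) = q x ⊓ q y)
    (x z : L) (hxz : x ⋖ z) :
    q x ⋖ q z ∨ q x = q z := by
  by_cases h : q x = q z
  · exact Or.inr h
  · left
    have hle : q x ≤ q z := by
      have := hsup x z
      rw [sup_eq_right.mpr hxz.le] at this
      rw [this]; exact le_sup_left
    refine ⟨lt_of_le_of_ne hle h, ?_⟩
    intro m h1 h2
    obtain ⟨y, rfl⟩ := hsurj m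
    have hw : q ((x ⊔ y) ⊓ z) = q y := by
      rw [hinf, hsup, sup_eq_right.mpr h1.le, inf_eq_left.mpr h2.le]
    rcases hxz.eq_or_eq (le_inf le_sup_left hxz.le) (inf_le_right : (x ⊔ y) ⊓ z ≤ z) with e | e
    · rw [e] at hw; exact h1.ne hw
    · rw [e] at hw; exact h2.ne hw.symm
end

section
/- Let q : L → M be a lattice quotient of finite lattices L and M. If {x₀, x₁, …, x_r} is a maximal chain of L, then {q(x₀), q(x₁), …, q(x_r)} is a maximal chain of M; hence q induces a well-defined map MaxChains(L) → MaxChains(M) sending a maximal chain to its image. -/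
/-- A lattice quotient `q : L → M` of finite lattices maps maximal chains of `L`
to maximal chains of `M`; hence it induces a well-defined map on maximal
chains, sending a maximal chain to its image. -/
theorem lattice_quotient_image_maxChain {L M : Type*} [Lattice L] [Lattice M]
    [Finite L] [Finite M]
    (q : L → M) (hsurj : Function.Surjective q)
    (hsup : ∀ x y : L, q (x ⊔ y) = q x ⊔ q y)
    (hinf : ∀ x y : L, q (x ⊓ y) = q x ⊓ q y)
    (C : Set L) (hC : IsMaxChain (· ≤ ·) C) :
    IsMaxChain (· ≤ ·) (q '' C) := by
  have hmono : Monotone q := by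
    intro x y h
    have h1 := hsup x y
    rw [sup_eq_right.2 h] at h1
    rw [h1]
    exact le_sup_left
  have htot : ∀ x ∈ C, ∀ y ∈ C, x ≤ y ∨ y ≤ x := fun x hx y hy => hC.1.total hx hy
  have hmem : ∀ z : L, (∀ c ∈ C, z ≤ c ∨ c ≤ z) → z ∈ C := by
    intro z hz
    have h1 : IsChain (· ≤ ·) (insert z C) := hC.1.insert (fun c hc _ => hz c hc)
    rw [hC.2 h1 (Set.subset_insert z C)]
    exact Set.mem_insert z C
  refine ⟨?_, ?_⟩
  · rintro _ ⟨x, hx, rfl⟩ _ ⟨y, hy, rfl⟩ _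
    exact (htot x hx y hy).imp (fun h => hmono h) (fun h => hmono h)
  · intro D hD hsub
    refine Set.Subset.antisymm hsub ?_
    intro m hm
    obtain ⟨w, rfl⟩ := hsurj m
    have hcmp : ∀ c ∈ C, q c ≤ q w ∨ q w ≤ q c := fun c hc =>
      hD.total (hsub ⟨c, hc, rfl⟩) hm
    haveI : Nonempty L := ⟨w⟩
    obtain ⟨t, ht⟩ := Set.finite_univ.bddAbove (s := (Set.univ : Set L))
    obtain ⟨b0, hb0⟩ := Set.finite_univ.bddBelow (s := (Set.univ : Set L))
    have ht' : ∀ x, x ≤ t := fun x => ht (Set.mem_univ x)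
    have hb' : ∀ x, b0 ≤ x := fun x => hb0 (Set.mem_univ x)
    obtain ⟨a, ha⟩ := (Set.toFinite {c | c ∈ C ∧ q c ≤ q w}).exists_maximal
      ⟨b0, hmem _ (fun c _ => Or.inl (hb' c)), hmono (hb' w)⟩
    obtain ⟨b, hb⟩ := (Set.toFinite {c | c ∈ C ∧ q w ≤ q c}).exists_minimal
      ⟨t, hmem _ (fun c _ => Or.inr (ht' c)), hmono (ht' w)⟩
    obtain ⟨⟨haC, haw⟩, hamax⟩ := ha
    obtain ⟨⟨hbC, hbw⟩, hbmin⟩ := hb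
    rcases htot a haC b hbC with hab | hba
    · refine ⟨(w ⊔ a) ⊓ b, hmem _ ?_, ?_⟩
      · intro c hc
        rcases hcmp c hc with h | h
        · right
          have hca : c ≤ a := (htot c hc a haC).elim id (fun h' => hamax ⟨hc, h⟩ h')
          exact hca.trans (le_inf le_sup_right hab)
        · left
          have hbc : b ≤ c := (htot b hbC c hc).elim id (fun h' => hbmin ⟨hc, h⟩ h')
          exact inf_le_right.trans hbc
      · rw [hinf, hsup, sup_eq_left.2 haw, inf_eq_left.2 hbw]
    · exact ⟨b, hbC, le_antisymm ((hmono hba).trans haw) hbw⟩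
end

section
/- Let q : L → M be a lattice quotient of finite lattices L and M. Then the induced map on maximal chains is surjective: for every maximal chain C of M there exists a maximal chain C' of L whose image under q (as a set) equals C. -/
/-- The map induced by a lattice quotient `q : L → M` of finite lattices on
maximal chains is surjective: every maximal chain of `M` is the image of a
maximal chain of `L`. -/
theorem lattice_quotient_maxChain_surjective {L M : Type*} [Lattice L] [Lattice M]
    [Finite L] [Finite M]
    (q : L → M) (hsurj : Function.Surjective q)
    (hsup : ∀ x y : L, q (x ⊔ y) = q x ⊔ q y)
    (hinf : ∀ x y : L, q (x ⊓ y) = q x ⊓ q y)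
    (C : Set M) (hC : IsMaxChain (· ≤ ·) C) :
    ∃ C' : Set L, IsMaxChain (· ≤ ·) C' ∧ q '' C' = C := by
  have hmono : Monotone q := by
    intro a b hab
    have h := hinf a b
    rw [inf_eq_left.mpr hab] at h
    exact inf_eq_left.mp h.symm
  have hleast : ∀ m : M, ∃ x : L, q x = m ∧ ∀ y, q y = m → x ≤ y := by
    intro m
    obtain ⟨x, hx⟩ := (Set.toFinite {x : L | q x = m}).exists_minimal (hsurj m)
    have hxm : q x = m := hx.1
    refine ⟨x, hxm, fun y hy => ?_⟩
    have hmem : q (x ⊓ y) = m := by rw [hinf, hxm, hy, inf_idem]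
    exact (hx.2 (y := x ⊓ y) hmem inf_le_left).trans inf_le_right
  choose s hs hsl using hleast
  have hsmono : Monotone s := by
    intro a b hab
    have hmem : q (s a ⊓ s b) = a := by rw [hinf, hs, hs, inf_eq_left.mpr hab]
    exact (hsl a _ hmem).trans inf_le_right
  have hch : IsChain (· ≤ ·) (s '' C) := hsmono.isChain_image hC.1
  obtain ⟨C', hsub⟩ := hch.exists_subset_flag
  refine ⟨C', C'.maxChain, ?_⟩
  refine (hC.2 (hmono.isChain_image C'.chain_le) ?_).symm
  intro m hm
  exact ⟨s m, hsub ⟨m, hm, rfl⟩, hs m⟩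
end

section
/- Let q : L → M be a lattice quotient of finite lattices L and M. If two maximal chains C and C' of L are square-equivalent, then their images q(C) and q(C') are square-equivalent maximal chains of M. Consequently there is a well-defined surjection from square-equivalence classes of maximal chains of L to square-equivalence classes of maximal chains of M, sending [C] to [q(C)]. -/
section Helpers

theorem aux_chain3 {α : Type*} [Lattice α] {x a y : α} (h1 : x ≤ a) (h2 : a ≤ y) :
    IsChain (fun s t : α => s ≤ t) {x, a, y} := by
  have h3 := h1.trans h2
  rintro s (rfl | rfl | rfl) t (rfl | rfl | rfl) hst <;> simp_all

theorem aux_unpack {α : Type*} [Lattice α] [Finite α] {x y : α} {P₁ P₂ : Set α}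
    (h : IsPolygonPair (fun s t : α => s ≤ t) x y P₁ P₂)
    (hc : (IccR (fun s t : α => s ≤ t) x y).ncard = 4) :
    ∃ a b, x ≤ a ∧ a ≤ y ∧ x ≤ b ∧ b ≤ y ∧ ¬ a ≤ b ∧ ¬ b ≤ a ∧
      (∀ z, x ≤ z → z ≤ y → z = x ∨ z = a ∨ z = b ∨ z = y) ∧
      P₁ = {x, a, y} ∧ P₂ = {x, b, y} := by
  obtain ⟨hxy, ⟨s1, c1, m1⟩, ⟨s2, c2, m2⟩, hne, hU, hI, -⟩ := h
  have hx1 : x ∈ P₁ ∩ P₂ := by rw [hI]; simp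
  have hy1 : y ∈ P₁ ∩ P₂ := by rw [hI]; simp
  have hsub : ∀ z, z ∈ P₁ → z ∈ P₂ → z = x ∨ z = y := by
    intro z h1 h2
    have : z ∈ P₁ ∩ P₂ := ⟨h1, h2⟩
    rw [hI] at this
    simpa using this
  have ha : ∃ a ∈ P₁, a ∉ P₂ := by
    by_contra hcon
    push Not at hcon
    exact hne (m1 P₂ s2 c2 hcon)
  have hb : ∃ b ∈ P₂, b ∉ P₁ := by
    by_contra hcon
    push Not at hcon
    exact hne (m2 P₁ s1 c1 hcon).symm
  obtain ⟨a, ha1, ha2⟩ := ha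
  obtain ⟨b, hb2, hb1⟩ := hb
  have hxa : x ≤ a := (s1 ha1).1
  have hay : a ≤ y := (s1 ha1).2
  have hxb : x ≤ b := (s2 hb2).1
  have hby : b ≤ y := (s2 hb2).2
  have nax : a ≠ x := fun h => ha2 (h ▸ hx1.2)
  have nay : a ≠ y := fun h => ha2 (h ▸ hy1.2)
  have nbx : b ≠ x := fun h => hb1 (h ▸ hx1.1)
  have nby : b ≠ y := fun h => hb1 (h ▸ hy1.1)
  have nab : a ≠ b := fun h => ha2 (h ▸ hb2)
  have nxy : x ≠ y := fun h => nax (le_antisymm (h ▸ hay) hxa)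
  have hIcc : ({x, a, b, y} : Set α) = IccR (fun s t : α => s ≤ t) x y := by
    apply Set.eq_of_subset_of_ncard_le
    · rintro z (rfl | rfl | rfl | rfl)
      · exact ⟨le_rfl, hxy⟩
      · exact ⟨hxa, hay⟩
      · exact ⟨hxb, hby⟩
      · exact ⟨hxy, le_rfl⟩
    · rw [hc, Set.ncard_insert_of_notMem, Set.ncard_insert_of_notMem, Set.ncard_pair nby]
      · simp [nab, nay]
      · simp [nax.symm, nbx.symm, nxy]
    · exact Set.toFinite _
  have hall : ∀ z, x ≤ z → z ≤ y → z = x ∨ z = a ∨ z = b ∨ z = y := by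
    intro z h1 h2
    have : z ∈ IccR (fun s t : α => s ≤ t) x y := ⟨h1, h2⟩
    rw [← hIcc] at this
    simpa using this
  have hP1 : P₁ = {x, a, y} := by
    ext z
    constructor
    · intro hz
      rcases hall z (s1 hz).1 (s1 hz).2 with h | h | h | h
      · simp [h]
      · simp [h]
      · exact absurd (h ▸ hz) hb1
      · simp [h]
    · rintro (rfl | rfl | rfl)
      exacts [hx1.1, ha1, hy1.1]
  have hP2 : P₂ = {x, b, y} := by
    ext z
    constructor
    · intro hz
      rcases hall z (s2 hz).1 (s2 hz).2 with h | h | h | h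
      · simp [h]
      · exact absurd (h ▸ hz) ha2
      · simp [h]
      · simp [h]
    · rintro (rfl | rfl | rfl)
      exacts [hx1.2, hb2, hy1.2]
  have key : a ≤ b ∨ b ≤ a → False := by
    intro hab
    apply hb1
    rw [m1 (insert b P₁) (Set.insert_subset (s2 hb2) s1) ?_ (Set.subset_insert _ _)]
    · simp
    · apply c1.insert
      intro z hz _
      rw [hP1] at hz
      rcases hz with rfl | rfl | rfl
      · exact Or.inr hxb
      · exact hab.symm
      · exact Or.inl hby
  exact ⟨a, b, hxa, hay, hxb, hby, fun h => key (Or.inl h), fun h => key (Or.inr h), hall, hP1, hP2⟩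

theorem aux_pack {α : Type*} [Lattice α] {x y a b : α}
    (hxa : x ≤ a) (hay : a ≤ y) (hxb : x ≤ b) (hby : b ≤ y) (h1 : ¬ a ≤ b) (h2 : ¬ b ≤ a)
    (hall : ∀ z, x ≤ z → z ≤ y → z = x ∨ z = a ∨ z = b ∨ z = y) :
    IsPolygonPair (fun s t : α => s ≤ t) x y {x, a, y} {x, b, y} ∧
      (IccR (fun s t : α => s ≤ t) x y).ncard = 4 := by
  have hxy := hxa.trans hay
  have nax : a ≠ x := fun h => h1 (h ▸ hxb)
  have nay : a ≠ y := fun h => h2 (h ▸ hby)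
  have nbx : b ≠ x := fun h => h2 (h ▸ hxa)
  have nby : b ≠ y := fun h => h1 (h ▸ hay)
  have nab : a ≠ b := fun h => h1 h.le
  have nxy : x ≠ y := fun h => nax (le_antisymm (h ▸ hay) hxa)
  have hIcc : IccR (fun s t : α => s ≤ t) x y = {x, a, b, y} := by
    ext z
    constructor
    · rintro ⟨h, h'⟩
      simpa using hall z h h'
    · rintro (rfl | rfl | rfl | rfl)
      · exact ⟨le_rfl, hxy⟩
      · exact ⟨hxa, hay⟩
      · exact ⟨hxb, hby⟩
      · exact ⟨hxy, le_rfl⟩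
  have hdich : ∀ C : Set α, C ⊆ IccR (fun s t : α => s ≤ t) x y →
      IsChain (fun s t : α => s ≤ t) C → C ⊆ {x, a, y} ∨ C ⊆ {x, b, y} := by
    intro C hC hch
    by_cases hb : b ∈ C
    · right
      intro z hz
      rcases hall z (hC hz).1 (hC hz).2 with h | h | h | h
      · simp [h]
      · subst h
        exact ((hch hz hb nab).elim h1 h2).elim
      · simp [h]
      · simp [h]
    · left
      intro z hz
      rcases hall z (hC hz).1 (hC hz).2 with h | h | h | h
      · simp [h]
      · simp [h]
      · exact absurd (h ▸ hz) hb
      · simp [h]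
  have sa : ({x, a, y} : Set α) ⊆ IccR (fun s t : α => s ≤ t) x y := by
    rw [hIcc]; intro z; simp; tauto
  have sb : ({x, b, y} : Set α) ⊆ IccR (fun s t : α => s ≤ t) x y := by
    rw [hIcc]; intro z; simp; tauto
  have ca := aux_chain3 hxa hay
  have cb := aux_chain3 hxb hby
  refine ⟨⟨hxy, ⟨sa, ca, ?_⟩, ⟨sb, cb, ?_⟩, ?_, ?_, ?_, ?_⟩, ?_⟩
  · intro C hC hch hs
    refine hs.antisymm ((hdich C hC hch).resolve_right fun h => ?_)
    have : a ∈ ({x, b, y} : Set α) := h (hs (by simp))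
    simp [nax, nay, nab] at this
  · intro C hC hch hs
    refine hs.antisymm ((hdich C hC hch).resolve_left fun h => ?_)
    have : b ∈ ({x, a, y} : Set α) := h (hs (by simp))
    simp [nbx, nby, nab.symm] at this
  · intro h
    have : a ∈ ({x, b, y} : Set α) := by rw [← h]; simp
    simp [nax, nay, nab] at this
  · rw [hIcc]; ext z; simp; tauto
  · ext z
    simp only [Set.mem_inter_iff, Set.mem_insert_iff, Set.mem_singleton_iff]
    constructor
    · rintro ⟨h | h | h, h' | h' | h'⟩ <;> simp_all
    · tauto
  · rintro C ⟨hC, hch, hm⟩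
    rcases hdich C hC hch with h | h
    · exact Or.inl (hm _ sa ca h)
    · exact Or.inr (hm _ sb cb h)
  · rw [hIcc, Set.ncard_insert_of_notMem, Set.ncard_insert_of_notMem, Set.ncard_pair nby]
    · simp [nab, nay]
    · simp [nax.symm, nbx.symm, nxy]

theorem aux_move {L M : Type*} [Lattice L] [Lattice M] [Finite L]
    (q : L → M) (hsurj : Function.Surjective q)
    (hsup : ∀ x y : L, q (x ⊔ y) = q x ⊔ q y)
    (hinf : ∀ x y : L, q (x ⊓ y) = q x ⊓ q y) {C C' : Set L}
    (hC : IsChain (fun s t : L => s ≤ t) C) (h : SquareMove (fun s t : L => s ≤ t) C C') :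
    IsChain (fun s t : L => s ≤ t) C' ∧
      SqEquiv (fun s t : M => s ≤ t) (q '' C) (q '' C') := by
  have hmono : Monotone q := by
    intro s t hst
    have := hsup s t
    rw [sup_eq_right.2 hst] at this
    exact sup_eq_right.1 this.symm
  obtain ⟨x, y, P₁, P₂, hP, hc, hs1, hs2, hd⟩ := h
  obtain ⟨a, b, hxa, hay, hxb, hby, nab, nba, hall, rfl, rfl⟩ := aux_unpack hP hc
  have hxC : x ∈ C := hs1 (by simp)
  have haC : a ∈ C := hs1 (by simp)
  have hyC : y ∈ C := hs1 (by simp)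
  have hR : ∀ r ∈ C, r ∉ ({x, a, y} : Set L) → r ≤ x ∨ y ≤ r := by
    intro r hr hn
    simp only [Set.mem_insert_iff, Set.mem_singleton_iff, not_or] at hn
    rcases hC.total hr hxC with h | h
    · exact Or.inl h
    rcases hC.total hr hyC with h' | h'
    · rcases hall r h h' with h | h | h | h
      · exact absurd h hn.1
      · exact absurd h hn.2.1
      · subst h
        exact ((hC.total hr haC).elim nba nab).elim
      · exact absurd h hn.2.2
    · exact Or.inr h'
  have hC'eq : C' = (C \ {x, a, y}) ∪ {x, b, y} := by
    rw [hd, Set.diff_union_of_subset hs2]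
  have hCeq : C = (C \ {x, a, y}) ∪ {x, a, y} := by
    rw [Set.diff_union_of_subset hs1]
  have hCC : ∀ r ∈ C', r ∈ C ∨ r = b := by
    intro r hr
    rw [hC'eq] at hr
    rcases hr with hr | rfl | rfl | rfl
    exacts [Or.inl hr.1, Or.inl hxC, Or.inr rfl, Or.inl hyC]
  have hbR : ∀ r ∈ C', r ≤ b ∨ b ≤ r := by
    intro r hr
    rw [hC'eq] at hr
    rcases hr with hr | rfl | rfl | rfl
    · exact (hR r hr.1 hr.2).imp (fun h => h.trans hxb) (fun h => hby.trans h)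
    exacts [Or.inl hxb, Or.inl le_rfl, Or.inr hby]
  refine ⟨?_, ?_⟩
  · intro r hr s hs hne
    rcases hCC r hr with h | rfl
    · rcases hCC s hs with h' | rfl
      · exact hC h h' hne
      · exact hbR r hr
    · exact (hbR s hs).symm
  have eab : a ⊓ b = x := by
    rcases hall (a ⊓ b) (le_inf hxa hxb) (inf_le_left.trans hay) with h | h | h | h
    · exact h
    · exact absurd (inf_eq_left.1 h) nab
    · exact absurd (inf_eq_right.1 h) nba
    · exact absurd (hay.trans (h ▸ inf_le_right)) nab
  have sab : a ⊔ b = y := by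
    rcases hall (a ⊔ b) (hxa.trans le_sup_left) (sup_le hay hby) with h | h | h | h
    · exact absurd (((h ▸ le_sup_left : a ≤ x)).trans hxb) nab
    · exact absurd (sup_eq_left.1 h) nba
    · exact absurd (sup_eq_right.1 h) nab
    · exact h
  have qi := hinf a b
  have qs := hsup a b
  rw [eab] at qi
  rw [sab] at qs
  have himC : q '' C = q '' (C \ {x, a, y}) ∪ {q x, q a, q y} := by
    conv_lhs => rw [hCeq]
    simp [Set.image_union, Set.image_insert_eq]
  have himC' : q '' C' = q '' (C \ {x, a, y}) ∪ {q x, q b, q y} := by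
    conv_lhs => rw [hC'eq]
    simp [Set.image_union, Set.image_insert_eq]
  by_cases h1 : q a ≤ q b
  · have e1 : q x = q a := by rw [qi, inf_eq_left.2 h1]
    have e2 : q y = q b := by rw [qs, sup_eq_right.2 h1]
    have : q '' C = q '' C' := by
      rw [himC, himC', e1, e2]; simp
    rw [this]
    exact Relation.ReflTransGen.refl
  by_cases h2 : q b ≤ q a
  · have e1 : q x = q b := by rw [qi, inf_eq_right.2 h2]
    have e2 : q y = q a := by rw [qs, sup_eq_left.2 h2]
    have : q '' C = q '' C' := by
      rw [himC, himC', e1, e2]; simp [Set.pair_comm]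
    rw [this]
    exact Relation.ReflTransGen.refl
  have hallM : ∀ z, q x ≤ z → z ≤ q y → z = q x ∨ z = q a ∨ z = q b ∨ z = q y := by
    intro z hz1 hz2
    obtain ⟨l, rfl⟩ := hsurj z
    have e : q ((l ⊔ x) ⊓ y) = q l := by
      rw [hinf, hsup, sup_eq_left.2 hz1, inf_eq_left.2 hz2]
    rw [← e]
    rcases hall ((l ⊔ x) ⊓ y) (le_inf le_sup_right (hxa.trans hay)) inf_le_right with
      h | h | h | h <;> rw [h] <;> simp
  obtain ⟨hp, hn⟩ := aux_pack (hmono hxa) (hmono hay) (hmono hxb) (hmono hby) h1 h2 hallM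
  have hRq : ∀ m ∈ q '' (C \ {x, a, y}), m ≤ q x ∨ q y ≤ m := by
    rintro _ ⟨r, hr, rfl⟩
    exact (hR r hr.1 hr.2).imp (fun h => hmono h) (fun h => hmono h)
  have hna : q a ∉ q '' (C \ {x, a, y}) := fun h =>
    (hRq _ h).elim (fun h => h1 (h.trans (hmono hxb))) (fun h => h2 ((hmono hby).trans h))
  have hnb : q b ∉ q '' (C \ {x, a, y}) := fun h =>
    (hRq _ h).elim (fun h => h2 (h.trans (hmono hxa))) (fun h => h1 ((hmono hay).trans h))
  refine Relation.ReflTransGen.single ⟨q x, q y, _, _, hp, hn, ?_, ?_, ?_⟩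
  · rw [himC]; exact Set.subset_union_right
  · rw [himC']; exact Set.subset_union_right
  · rw [himC, himC', Set.union_diff_right, Set.union_diff_right]
    ext z
    simp only [Set.mem_diff, Set.mem_insert_iff, Set.mem_singleton_iff, not_or]
    constructor
    · rintro ⟨hz, hz1, -, hz2⟩
      exact ⟨hz, hz1, fun h => hnb (h ▸ hz), hz2⟩
    · rintro ⟨hz, hz1, -, hz2⟩
      exact ⟨hz, hz1, fun h => hna (h ▸ hz), hz2⟩

theorem aux_max {L M : Type*} [Lattice L] [Lattice M] [Finite L]
    (q : L → M) (hsurj : Function.Surjective q)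
    (hsup : ∀ x y : L, q (x ⊔ y) = q x ⊔ q y)
    (hinf : ∀ x y : L, q (x ⊓ y) = q x ⊓ q y) {C : Set L}
    (hC : IsMaxChain (fun s t : L => s ≤ t) C) :
    IsMaxChain (fun s t : M => s ≤ t) (q '' C) := by
  have hmono : Monotone q := by
    intro s t hst
    have := hsup s t
    rw [sup_eq_right.2 hst] at this
    exact sup_eq_right.1 this.symm
  have hch := hC.1
  refine ⟨?_, ?_⟩
  · rintro _ ⟨s, hs, rfl⟩ _ ⟨t, ht, rfl⟩ _
    exact (hch.total hs ht).imp (fun h => hmono h) (fun h => hmono h)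
  intro D hD hsub
  refine Set.Subset.antisymm hsub ?_
  intro m hm
  obtain ⟨l, rfl⟩ := hsurj m
  have : Nonempty L := ⟨l⟩
  have hadd : ∀ e : L, (∀ c ∈ C, e ≤ c ∨ c ≤ e) → e ∈ C := by
    intro e he
    have hi : IsChain (fun s t : L => s ≤ t) (insert e C) := hch.insert fun c hc _ => he c hc
    rw [hC.2 hi (Set.subset_insert _ _)]
    exact Set.mem_insert _ _
  obtain ⟨z, hz⟩ : ∃ z : L, ∀ w, z ≤ w := by
    obtain ⟨z, hz⟩ := (Set.toFinite (Set.univ : Set L)).exists_minimal ⟨l, trivial⟩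
    exact ⟨z, fun w => (hz.2 (Set.mem_univ _) (inf_le_left : z ⊓ w ≤ z)).trans inf_le_right⟩
  obtain ⟨u, hu⟩ : ∃ z : L, ∀ w, w ≤ z := by
    obtain ⟨z, hz⟩ := (Set.toFinite (Set.univ : Set L)).exists_maximal ⟨l, trivial⟩
    exact ⟨z, fun w => le_sup_right.trans (hz.2 (Set.mem_univ _) (le_sup_left : z ≤ z ⊔ w))⟩
  obtain ⟨c, ⟨hcC, hcl⟩, hcm⟩ := (Set.toFinite {c | c ∈ C ∧ q c ≤ q l}).exists_maximal
    ⟨z, hadd z fun c _ => Or.inl (hz c), hmono (hz l)⟩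
  obtain ⟨d, ⟨hdC, hdl⟩, hdm⟩ := (Set.toFinite {d | d ∈ C ∧ q l ≤ q d}).exists_minimal
    ⟨u, hadd u fun c _ => Or.inr (hu c), hmono (hu l)⟩
  rcases hch.total hdC hcC with hdc | hcd
  · exact ⟨c, hcC, le_antisymm hcl (hdl.trans (hmono hdc))⟩
  refine ⟨(l ⊔ c) ⊓ d, hadd _ ?_, ?_⟩
  · intro e he
    rcases hD.total hm (hsub ⟨e, he, rfl⟩) with h | h
    · left
      refine inf_le_right.trans ?_
      rcases hch.total hdC he with h' | h'
      · exact h'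
      · exact hdm ⟨he, h⟩ h'
    · right
      refine le_trans ?_ (le_inf le_sup_right hcd)
      rcases hch.total he hcC with h' | h'
      · exact h'
      · exact hcm ⟨he, h⟩ h'
  · rw [hinf, hsup, sup_eq_left.2 hcl, inf_eq_left.2 hdl]

theorem aux_lift {L M : Type*} [Lattice L] [Lattice M] [Finite L]
    (q : L → M) (hsurj : Function.Surjective q)
    (hsup : ∀ x y : L, q (x ⊔ y) = q x ⊔ q y)
    (hinf : ∀ x y : L, q (x ⊓ y) = q x ⊓ q y) {D : Set M}
    (hD : IsMaxChain (fun s t : M => s ≤ t) D) :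
    ∃ C : Set L, IsMaxChain (fun s t : L => s ≤ t) C ∧ q '' C = D := by
  have hs : ∀ m : M, ∃ l : L, q l = m ∧ ∀ l', q l' = m → l' ≤ l → l ≤ l' := by
    intro m
    obtain ⟨l, hl⟩ := (Set.toFinite {l | q l = m}).exists_minimal (hsurj m)
    exact ⟨l, hl.1, fun l' h h' => hl.2 h h'⟩
  choose s hs1 hs2 using hs
  have smono : ∀ m m', m ≤ m' → s m ≤ s m' := by
    intro m m' h
    refine (hs2 m (s m ⊓ s m') ?_ inf_le_left).trans inf_le_right
    rw [hinf, hs1, hs1, inf_eq_left.2 h]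
  have hch : IsChain (fun s t : L => s ≤ t) (s '' D) := by
    rintro _ ⟨m, hm, rfl⟩ _ ⟨m', hm', rfl⟩ _
    exact (hD.1.total hm hm').imp (smono _ _) (smono _ _)
  obtain ⟨C, hC, hsub⟩ := hch.exists_maxChain
  refine ⟨C, hC, (hD.2 (aux_max q hsurj hsup hinf hC).1 ?_).symm⟩
  intro m hm
  exact ⟨s m, hsub ⟨m, hm, rfl⟩, hs1 m⟩

end Helpers

/-- Let `q : L → M` be a lattice quotient of finite lattices.  If two maximal
chains `C`, `C'` of `L` are square-equivalent, then their images are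
square-equivalent maximal chains of `M`.  Consequently there is a well-defined
surjection on square-equivalence classes of maximal chains, `[C] ↦ [q '' C]`. -/
theorem lattice_quotient_sqEquiv {L M : Type*} [Lattice L] [Lattice M]
    [Finite L] [Finite M]
    (q : L → M) (hsurj : Function.Surjective q)
    (hsup : ∀ x y : L, q (x ⊔ y) = q x ⊔ q y)
    (hinf : ∀ x y : L, q (x ⊓ y) = q x ⊓ q y) :
    (∀ C C' : Set L, IsMaxChain (· ≤ ·) C → IsMaxChain (· ≤ ·) C' →
      SqEquiv (· ≤ ·) C C' →
      IsMaxChain (· ≤ ·) (q '' C) ∧ IsMaxChain (· ≤ ·) (q '' C') ∧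
        SqEquiv (· ≤ ·) (q '' C) (q '' C')) ∧
    (∀ D : Set M, IsMaxChain (· ≤ ·) D →
      ∃ C : Set L, IsMaxChain (· ≤ ·) C ∧ SqEquiv (· ≤ ·) (q '' C) D) := by
  refine ⟨?_, ?_⟩
  · intro C C' hC hC' h
    refine ⟨aux_max q hsurj hsup hinf hC, aux_max q hsurj hsup hinf hC', ?_⟩
    have key : IsChain (fun s t : L => s ≤ t) C' ∧
        SqEquiv (fun s t : M => s ≤ t) (q '' C) (q '' C') := by
      clear hC'
      induction h with
      | refl => exact ⟨hC.1, Relation.ReflTransGen.refl⟩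
      | tail _ hm ih =>
        obtain ⟨h1, h2⟩ := aux_move q hsurj hsup hinf ih.1 hm
        exact ⟨h1, Relation.ReflTransGen.trans ih.2 h2⟩
    exact key.2
  · intro D hD
    obtain ⟨C, hC, rfl⟩ := aux_lift q hsurj hsup hinf hD
    exact ⟨C, hC, Relation.ReflTransGen.refl⟩
end

section
/- Let q : L → M be a lattice quotient of finite lattices with L polygonal. Given two maximal chains C_M and C'_M of M which differ by a polygon move, there exist maximal chains C_L and C'_L of L which are related by a polygon move and satisfy q(C_L) = C_M and q(C'_L) = C'_M (as sets). -/
/-! Lattice-specific definitions: polygonal lattices, lattice congruences,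
forcing, forcing-consistent and polygonal edge labellings. -/

section LatticeDefs

/-- A finite lattice is polygonal if joins of two covers of a common element
and meets of two elements covered by a common element always span polygons. -/
def IsPolygonalLattice (L : Type*) [Lattice L] : Prop :=
  (∀ x y₁ y₂ : L, y₁ ≠ y₂ → x ⋖ y₁ → x ⋖ y₂ →
    IsPolygon (α := L) (· ≤ ·) (IccR (· ≤ ·) x (y₁ ⊔ y₂))) ∧
  (∀ x₁ x₂ y : L, x₁ ≠ x₂ → x₁ ⋖ y → x₂ ⋖ y →
    IsPolygon (α := L) (· ≤ ·) (IccR (· ≤ ·) (x₁ ⊓ x₂) y))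

/-- A lattice congruence: an equivalence relation compatible with joins and
meets. -/
def IsLatticeCongruence {L : Type*} [Lattice L] (θ : L → L → Prop) : Prop :=
  Equivalence θ ∧ ∀ x y z : L, θ x y → θ (x ⊔ z) (y ⊔ z) ∧ θ (x ⊓ z) (y ⊓ z)

/-- The covering relation `a ⋖ b` forces `c ⋖ d`: every lattice congruence
identifying `a` and `b` identifies `c` and `d`. -/
def Forces {L : Type*} [Lattice L] (a b c d : L) : Prop :=
  ∀ θ : L → L → Prop, IsLatticeCongruence θ → θ a b → θ c d

/-- Two covering relations are forcing-equivalent if each forces the other. -/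
def ForcingEquiv {L : Type*} [Lattice L] (a b c d : L) : Prop :=
  Forces a b c d ∧ Forces c d a b

/-- An edge labelling is forcing-consistent if forcing-equivalent covering
relations receive equal labels. -/
def ForcingConsistent {L E : Type*} [Lattice L] (lab : L → L → E) : Prop :=
  ∀ a b c d : L, a ⋖ b → c ⋖ d → ForcingEquiv a b c d → lab a b = lab c d

/-- An edge labelling is polygonal if in every non-square polygon one maximal
chain is ascending and the other descending. -/
def PolygonalLabelling {L E : Type*} [Lattice L] [PartialOrder E]
    (lab : L → L → E) : Prop :=
  ∀ (x y : L) (C₁ C₂ : Set L), IsPolygonPair (· ≤ ·) x y C₁ C₂ →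
    (IccR (α := L) (· ≤ ·) x y).ncard ≠ 4 →
    (ChainAscending (· ≤ ·) lab (· < ·) C₁ ∧
      ChainAscending (· ≤ ·) lab (fun a b => b < a) C₂) ∨
    (ChainAscending (· ≤ ·) lab (· < ·) C₂ ∧
      ChainAscending (· ≤ ·) lab (fun a b => b < a) C₁)

end LatticeDefs

theorem exists_maxChainIn_aux {α : Type*} [Finite α] (r : α → α → Prop) (S C : Set α)
    (hCS : C ⊆ S) (hC : IsChain r C) : ∃ D, C ⊆ D ∧ MaxChainIn r S D := by
  obtain ⟨D, hCD, hD⟩ := Set.Finite.exists_le_maximal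
    (s := {E : Set α | E ⊆ S ∧ IsChain r E}) (Set.toFinite _) (a := C) ⟨hCS, hC⟩
  exact ⟨D, hCD, hD.1.1, hD.1.2, fun E h1 h2 h3 => Set.Subset.antisymm h3 (hD.2 ⟨h1, h2⟩ h3)⟩

theorem IsPolygonPair.swap_aux {α : Type*} {r : α → α → Prop} {x y : α} {P Q : Set α}
    (h : IsPolygonPair r x y P Q) : IsPolygonPair r x y Q P := by
  obtain ⟨h1, h2, h3, h4, h5, h6, h7⟩ := h
  exact ⟨h1, h3, h2, h4.symm, by rw [h5, Set.union_comm], by rw [← h6, Set.inter_comm],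
    fun C hC => (h7 C hC).symm⟩

section
variable {α : Type*} [Lattice α] {x y : α} {P Q : Set α}

theorem pp_key_aux [Finite α] (h : IsPolygonPair (· ≤ ·) x y P Q) {m n : α} (hm : m ∈ P)
    (hn : n ∈ Q) (hmn : m ≤ n ∨ n ≤ m) : (m = x ∨ m = y) ∨ (n = x ∨ n = y) := by
  obtain ⟨h1, h2, h3, h4, h5, h6, h7⟩ := h
  obtain ⟨D, hD, hD'⟩ := exists_maxChainIn_aux (· ≤ ·) (IccR (· ≤ ·) x y) {m, n}
    (by rintro z (rfl | rfl)
        · exact h2.1 hm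
        · exact h3.1 hn)
    (by
      rintro a (rfl | rfl) b (rfl | rfl) hab
      · exact absurd rfl hab
      · exact hmn
      · exact hmn.symm
      · exact absurd rfl hab)
  have e : ∀ z, z ∈ P → z ∈ Q → z = x ∨ z = y := fun z a b => by
    have : z ∈ P ∩ Q := ⟨a, b⟩
    rw [h6] at this
    exact this
  rcases h7 D hD' with rfl | rfl
  · exact Or.inr (e n (hD (by simp)) hn)
  · exact Or.inl (e m hm (hD (by simp)))

theorem mc_mem_aux {S C : Set α} (h : MaxChainIn (· ≤ ·) S C) {z : α} (hz : z ∈ S)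
    (hc : ∀ c ∈ C, z ≤ c ∨ c ≤ z) : z ∈ C := by
  have := h.2.2 (insert z C) (Set.insert_subset hz h.1)
    (h.2.1.insert fun b hb _ => hc b hb) (Set.subset_insert _ _)
  rw [this]; exact Set.mem_insert _ _

theorem pp_ends_aux (h : IsPolygonPair (· ≤ ·) x y P Q) : x ∈ P ∧ y ∈ P ∧ x ∈ Q ∧ y ∈ Q := by
  have h6 := h.2.2.2.2.2.1
  have hx : x ∈ P ∩ Q := by rw [h6]; simp
  have hy : y ∈ P ∩ Q := by rw [h6]; simp
  exact ⟨hx.1, hy.1, hx.2, hy.2⟩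

theorem pp_interior_aux (h : IsPolygonPair (· ≤ ·) x y P Q) : ∃ c ∈ P, c ≠ x ∧ c ≠ y := by
  by_contra! hc
  obtain ⟨hx, hy, hx', hy'⟩ := pp_ends_aux h
  refine h.2.2.2.1 (h.2.1.2.2 Q h.2.2.1.1 h.2.2.1.2.1 fun c hcP => ?_)
  by_cases e : c = x
  · exact e ▸ hx'
  · exact hc c hcP e ▸ hy'

theorem maxchain_mem_aux {C : Set α} (h : IsMaxChain (· ≤ ·) C) {z : α}
    (hc : ∀ c ∈ C, z ≤ c ∨ c ≤ z) : z ∈ C := by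
  have := h.2 (h.1.insert fun b hb _ => hc b hb) (Set.subset_insert z C)
  rw [this]; exact Set.mem_insert _ _

theorem maxchain_split_aux {C : Set α} (h : IsPolygonPair (· ≤ ·) x y P Q)
    (hC : IsChain (· ≤ ·) C) (hP : P ⊆ C) {c : α} (hc : c ∈ C) (hcP : c ∉ P) :
    c < x ∨ y < c := by
  obtain ⟨hx, hy, -, -⟩ := pp_ends_aux h
  have n1 : c ≠ x := fun e => hcP (e ▸ hx)
  have n2 : c ≠ y := fun e => hcP (e ▸ hy)
  rcases hC.total hc (hP hx) with h1 | h1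
  · exact Or.inl (lt_of_le_of_ne h1 n1)
  rcases hC.total hc (hP hy) with h2 | h2
  · exact absurd (mc_mem_aux h.2.1 ⟨h1, h2⟩ fun d hd => hC.total hc (hP hd)) hcP
  · exact Or.inr (lt_of_le_of_ne h2 n2.symm)

/-- Exchanging one side of a polygon in a maximal chain gives a maximal chain. -/
theorem maxchain_swap_aux {C : Set α} (h : IsPolygonPair (· ≤ ·) x y P Q)
    (hC : IsMaxChain (· ≤ ·) C) (hP : P ⊆ C) : IsMaxChain (· ≤ ·) ((C \ P) ∪ Q) := by
  obtain ⟨hx, hy, hx', hy'⟩ := pp_ends_aux h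
  have sp : ∀ c ∈ C, c ∉ P → c < x ∨ y < c := fun c => maxchain_split_aux h hC.1 hP
  have hQ : ∀ d ∈ Q, x ≤ d ∧ d ≤ y := fun d hd => h.2.2.1.1 hd
  have hPI : ∀ d ∈ P, x ≤ d ∧ d ≤ y := fun d hd => h.2.1.1 hd
  have cr : ∀ c ∈ C, c ∉ P → ∀ d ∈ Q, c ≤ d ∨ d ≤ c := fun c hc hcP d hd => by
    rcases sp c hc hcP with h1 | h1
    · exact Or.inl (h1.le.trans (hQ d hd).1)
    · exact Or.inr ((hQ d hd).2.trans h1.le)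
  refine ⟨?_, fun D hD hsub => Set.Subset.antisymm hsub fun z hz => ?_⟩
  · rintro a (⟨ha, ha'⟩ | ha) b (⟨hb, hb'⟩ | hb) hab
    · exact hC.1 ha hb hab
    · exact cr a ha ha' b hb
    · exact (cr b hb hb' a ha).symm
    · exact h.2.2.1.2.1 ha hb hab
  · have hz' : ∀ c ∈ (C \ P) ∪ Q, z ≤ c ∨ c ≤ z := fun c hc => hD.total hz (hsub hc)
    by_cases hI : x ≤ z ∧ z ≤ y
    · exact Or.inr (mc_mem_aux h.2.2.1 hI fun c hc => hz' c (Or.inr hc))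
    · left
      refine ⟨maxchain_mem_aux hC fun c hc => ?_, fun hzP => hI (hPI z hzP)⟩
      by_cases hcP : c ∈ P
      · rcases hz' x (Or.inr hx') with h1 | h1
        · exact Or.inl (h1.trans (hPI c hcP).1)
        rcases hz' y (Or.inr hy') with h2 | h2
        · exact absurd ⟨h1, h2⟩ hI
        · exact Or.inr ((hPI c hcP).2.trans h2)
      · exact hz' c (Or.inl ⟨hc, hcP⟩)

end

/-- Let `q : L → M` be a lattice quotient of finite lattices with `L` polygonal.
Given two maximal chains of `M` differing by a polygon move, there are maximal
chains of `L` related by a polygon move whose images are the given chains. -/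
theorem polygon_move_lifts {L M : Type*} [Lattice L] [Lattice M]
    [Finite L] [Finite M] (hL : IsPolygonalLattice L)
    (q : L → M) (hsurj : Function.Surjective q)
    (hsup : ∀ x y : L, q (x ⊔ y) = q x ⊔ q y)
    (hinf : ∀ x y : L, q (x ⊓ y) = q x ⊓ q y)
    (CM CM' : Set M) (hCM : IsMaxChain (· ≤ ·) CM) (hCM' : IsMaxChain (· ≤ ·) CM')
    (hmove : PolygonMove (· ≤ ·) CM CM') :
    ∃ CL CL' : Set L, IsMaxChain (· ≤ ·) CL ∧ IsMaxChain (· ≤ ·) CL' ∧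
      PolygonMove (· ≤ ·) CL CL' ∧ q '' CL = CM ∧ q '' CL' = CM' := by
  obtain ⟨x, y, P₁, P₂, hP, hP₁, hP₂, hdiff⟩ := hmove
  have hmono : ∀ a b : L, a ≤ b → q a ≤ q b := fun a b hab => by
    rw [← sup_eq_right, ← hsup, sup_eq_right.2 hab]
  have hup : ∀ m : M, ∃ t : L, q t = m ∧ ∀ s, q s ≤ m → s ≤ t := fun m => by
    obtain ⟨s0, hs0⟩ := hsurj m
    obtain ⟨t, -, ht⟩ := Set.Finite.exists_le_maximal
      (s := {s : L | q s ≤ m}) (Set.toFinite _) (a := s0) hs0.le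
    have key : ∀ s, q s ≤ m → s ≤ t := fun s hs =>
      le_sup_left.trans (ht.2 (y := s ⊔ t) (by
        change q (s ⊔ t) ≤ m
        rw [hsup]; exact sup_le hs ht.1) le_sup_right)
    exact ⟨t, le_antisymm ht.1 (hs0 ▸ hmono _ _ (key s0 hs0.le)), key⟩
  choose up hup1 hup2 using hup
  have upmono : ∀ a b, a ≤ b → up a ≤ up b := fun a b hab => hup2 b _ ((hup1 a).trans_le hab)
  have chimg : ∀ C : Set L, IsChain (· ≤ ·) C → IsChain (· ≤ ·) (q '' C) := by
    rintro C hC _ ⟨a, ha, rfl⟩ _ ⟨b, hb, rfl⟩ -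
    exact (hC.total ha hb).imp (hmono _ _) (hmono _ _)
  -- covers of the top of the fibre over x
  have cov : ∀ P Q : Set M, IsPolygonPair (· ≤ ·) x y P Q →
      ∃ b, up x ⋖ b ∧ q b ∈ P ∧ q b ≠ x ∧ q b ≠ y := fun P Q hPQ => by
    obtain ⟨c, hc, hcx, hcy⟩ := pp_interior_aux hPQ
    obtain ⟨hxc, hcy'⟩ := hPQ.2.1.1 hc
    have hlt : up x < up c := lt_of_le_of_ne (upmono _ _ hxc) fun e => hcx (by
      rw [← hup1 c, ← e, hup1])
    obtain ⟨b, hb, hbc⟩ := exists_covBy_le_of_lt hlt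
    have h1 : x ≤ q b := by simpa [hup1] using hmono _ _ hb.le
    have h2 : q b ≤ c := by simpa [hup1] using hmono _ _ hbc
    have h3 : q b ≠ x := fun e => hb.lt.not_ge (hup2 x b e.le)
    have h4 : q b ≠ y := fun e => hcy (le_antisymm hcy' (e ▸ h2))
    refine ⟨b, hb, ?_, h3, h4⟩
    have hmem : q b ∈ P ∪ Q := by
      rw [← hPQ.2.2.2.2.1]; exact ⟨h1, h2.trans hcy'⟩
    rcases hmem with h | h
    · exact h
    · rcases pp_key_aux hPQ hc h (Or.inr h2) with (h | h) | (h | h)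
      · exact absurd h hcx
      · exact absurd h hcy
      · exact absurd h h3
      · exact absurd h h4
  obtain ⟨b₁, hb₁, ha₁, ha₁x, ha₁y⟩ := cov _ _ hP
  obtain ⟨b₂, hb₂, ha₂, ha₂x, ha₂y⟩ := cov _ _ hP.swap_aux
  have hinc : ¬ (q b₁ ≤ q b₂ ∨ q b₂ ≤ q b₁) := fun h => by
    rcases pp_key_aux hP ha₁ ha₂ h with (h | h) | (h | h) <;> contradiction
  have hbne : b₁ ≠ b₂ := fun e => hinc (Or.inl (by rw [e]))
  have hPI₁ : ∀ d ∈ P₁, x ≤ d ∧ d ≤ y := fun d hd => hP.2.1.1 hd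
  have hPI₂ : ∀ d ∈ P₂, x ≤ d ∧ d ≤ y := fun d hd => hP.2.2.1.1 hd
  have hqv : q (b₁ ⊔ b₂) = y := by
    rw [hsup]
    have hle : q b₁ ⊔ q b₂ ≤ y := sup_le (hPI₁ _ ha₁).2 (hPI₂ _ ha₂).2
    have hxle : x ≤ q b₁ ⊔ q b₂ := (hPI₁ _ ha₁).1.trans le_sup_left
    have hnx : q b₁ ⊔ q b₂ ≠ x := fun e =>
      ha₁x (le_antisymm (le_sup_left.trans e.le) (hPI₁ _ ha₁).1)
    have hmem : q b₁ ⊔ q b₂ ∈ P₁ ∪ P₂ := by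
      rw [← hP.2.2.2.2.1]; exact ⟨hxle, hle⟩
    rcases hmem with h | h
    · rcases pp_key_aux hP h ha₂ (Or.inr le_sup_right) with (h | h) | (h | h)
      · exact absurd h hnx
      · exact h
      · exact absurd h ha₂x
      · exact absurd h ha₂y
    · rcases pp_key_aux hP ha₁ h (Or.inl le_sup_left) with (h | h) | (h | h)
      · exact absurd h ha₁x
      · exact absurd h ha₁y
      · exact absurd h hnx
      · exact h
  have hqu := hup1 x
  have hpoly := hL.1 (up x) b₁ b₂ hbne hb₁ hb₂
  have huv : up x ≤ b₁ ⊔ b₂ := hb₁.le.trans le_sup_left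
  have hb₁v : b₁ ≤ b₁ ⊔ b₂ := le_sup_left
  have hb₂v : b₂ ≤ b₁ ⊔ b₂ := le_sup_right
  have hyv : ∀ d, y ≤ d → b₁ ⊔ b₂ ≤ up d := fun d hd => hup2 d _ (hqv.trans_le hd)
  generalize b₁ ⊔ b₂ = v at *
  generalize hu : up x = u at *
  obtain ⟨Q₁, Q₂, hQ, hbQ₁, hbQ₂⟩ : ∃ Q₁ Q₂ : Set L, IsPolygonPair (· ≤ ·) u v Q₁ Q₂ ∧
      b₁ ∈ Q₁ ∧ b₂ ∈ Q₂ := by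
    obtain ⟨u', v', Q, Q', hI, hQ⟩ := hpoly
    have e1 : u ∈ IccR (· ≤ ·) u' v' := by rw [← hI]; exact ⟨le_rfl, huv⟩
    have e2 : v ∈ IccR (· ≤ ·) u' v' := by rw [← hI]; exact ⟨huv, le_rfl⟩
    have e3 : u' ∈ IccR (· ≤ ·) u v := by rw [hI]; exact ⟨le_rfl, hQ.1⟩
    have e4 : v' ∈ IccR (· ≤ ·) u v := by rw [hI]; exact ⟨hQ.1, le_rfl⟩
    obtain rfl : u = u' := le_antisymm e3.1 e1.1
    obtain rfl : v = v' := le_antisymm e2.2 e4.2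
    have m1 : b₁ ∈ Q ∪ Q' := by rw [← hQ.2.2.2.2.1]; exact ⟨hb₁.le, hb₁v⟩
    have m2 : b₂ ∈ Q ∪ Q' := by rw [← hQ.2.2.2.2.1]; exact ⟨hb₂.le, hb₂v⟩
    have no : ∀ R : Set L, IsChain (· ≤ ·) R → b₁ ∈ R → b₂ ∈ R → False := fun R hR h1 h2 =>
      hinc ((hR.total h1 h2).imp (hmono _ _) (hmono _ _))
    rcases m1 with m1 | m1 <;> rcases m2 with m2 | m2
    · exact (no Q hQ.2.1.2.1 m1 m2).elim
    · exact ⟨Q, Q', hQ, m1, m2⟩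
    · exact ⟨Q', Q, hQ.swap_aux, m1, m2⟩
    · exact (no Q' hQ.2.2.1.2.1 m1 m2).elim
  obtain ⟨hu₁, hv₁, hu₂, hv₂⟩ := pp_ends_aux hQ
  have lift : ∀ m, x ≤ m → m ≤ y → ∃ s ∈ Q₁ ∪ Q₂, q s = m := fun m h1 h2 => by
    obtain ⟨t, rfl⟩ := hsurj m
    refine ⟨(t ⊔ u) ⊓ v, ?_, ?_⟩
    · rw [← hQ.2.2.2.2.1]
      exact ⟨le_inf le_sup_right huv, inf_le_right⟩
    · rw [hinf, hsup, hqv, hqu, sup_eq_left.2 h1, inf_eq_left.2 h2]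
  have lift₁ : ∀ m ∈ P₁, ∃ s ∈ Q₁, q s = m := fun m hm => by
    obtain ⟨s, hs | hs, rfl⟩ := lift m (hPI₁ m hm).1 (hPI₁ m hm).2
    · exact ⟨s, hs, rfl⟩
    · rcases pp_key_aux hP hm ha₂ ((hQ.2.2.1.2.1.total hs hbQ₂).imp (hmono _ _) (hmono _ _))
        with (h | h) | (h | h)
      · exact ⟨u, hu₁, hqu.trans h.symm⟩
      · exact ⟨v, hv₁, hqv.trans h.symm⟩
      · exact absurd h ha₂x
      · exact absurd h ha₂y
  have lift₂ : ∀ m ∈ P₂, ∃ s ∈ Q₂, q s = m := fun m hm => by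
    obtain ⟨s, hs | hs, rfl⟩ := lift m (hPI₂ m hm).1 (hPI₂ m hm).2
    · rcases pp_key_aux hP ha₁ hm ((hQ.2.1.2.1.total hbQ₁ hs).imp (hmono _ _) (hmono _ _))
        with (h | h) | (h | h)
      · exact absurd h ha₁x
      · exact absurd h ha₁y
      · exact ⟨u, hu₂, hqu.trans h.symm⟩
      · exact ⟨v, hv₂, hqv.trans h.symm⟩
    · exact ⟨s, hs, rfl⟩
  have sp : ∀ c ∈ CM, c ∉ P₁ → c < x ∨ y < c := fun c => maxchain_split_aux hP hCM.1 hP₁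
  have hQI : ∀ d ∈ Q₁, u ≤ d ∧ d ≤ v := fun d hd => hQ.2.1.1 hd
  have cr : ∀ c ∈ CM, c ∉ P₁ → ∀ d ∈ Q₁, up c ≤ d ∨ d ≤ up c := fun c hc hcP d hd => by
    rcases sp c hc hcP with h | h
    · exact Or.inl ((hu ▸ upmono _ _ h.le : up c ≤ u).trans (hQI d hd).1)
    · exact Or.inr ((hQI d hd).2.trans (hyv _ h.le))
  have hA : IsChain (· ≤ ·) (up '' (CM \ P₁) ∪ Q₁) := by
    rintro a (⟨a, ⟨ha, ha'⟩, rfl⟩ | ha) b (⟨b, ⟨hb, hb'⟩, rfl⟩ | hb) hab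
    · exact (hCM.1.total ha hb).imp (upmono _ _) (upmono _ _)
    · exact cr a ha ha' b hb
    · exact (cr b hb hb' a ha).symm
    · exact hQ.2.1.2.1 ha hb hab
  obtain ⟨D, hAD, hDm⟩ := exists_maxChainIn_aux (· ≤ ·) Set.univ _ (Set.subset_univ _) hA
  have hD : IsMaxChain (· ≤ ·) D :=
    ⟨hDm.2.1, fun E hE hDE => hDm.2.2 E (Set.subset_univ _) hE hDE⟩
  have hQD : Q₁ ⊆ D := Set.subset_union_right.trans hAD
  have hD' := maxchain_swap_aux hQ hD hQD
  have upQ : ∀ c ∈ CM, c ∉ P₁ → up c ∉ Q₁ := fun c hc hcP h => by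
    have h1 := hmono _ _ (hQI _ h).1
    have h2 := hmono _ _ (hQI _ h).2
    rw [hup1] at h1 h2
    rw [hqu] at h1
    rw [hqv] at h2
    rcases sp c hc hcP with h | h
    · exact h.not_ge h1
    · exact h.not_ge h2
  refine ⟨D, (D \ Q₁) ∪ Q₂, hD, hD', ⟨u, v, Q₁, Q₂, hQ, hQD, Set.subset_union_right, ?_⟩, ?_, ?_⟩
  · ext z
    constructor
    · rintro ⟨h1, h2⟩
      refine ⟨Or.inl ⟨h1, h2⟩, fun h3 => ?_⟩
      rcases maxchain_split_aux hQ hD.1 hQD h1 h2 with h | h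
      · exact h.not_ge (hQ.2.2.1.1 h3).1
      · exact h.not_ge (hQ.2.2.1.1 h3).2
    · rintro ⟨h1 | h1, h2⟩
      · exact h1
      · exact absurd h1 h2
  · refine (hCM.2 (chimg D hD.1) fun c hc => ?_).symm
    by_cases hcP : c ∈ P₁
    · obtain ⟨s, hs, rfl⟩ := lift₁ c hcP
      exact ⟨s, hQD hs, rfl⟩
    · exact ⟨up c, hAD (Or.inl ⟨c, ⟨hc, hcP⟩, rfl⟩), hup1 c⟩
  · refine (hCM'.2 (chimg _ hD'.1) fun c hc => ?_).symm
    by_cases hcP : c ∈ P₂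
    · obtain ⟨s, hs, rfl⟩ := lift₂ c hcP
      exact ⟨s, Or.inr hs, rfl⟩
    · have hc' : c ∈ CM \ P₁ := by rw [hdiff]; exact ⟨hc, hcP⟩
      exact ⟨up c, Or.inl ⟨hAD (Or.inl ⟨c, hc', rfl⟩), upQ c hc'.1 hc'.2⟩, hup1 c⟩
end

section
/- Let L be a finite polygonal lattice and let q : L → M be a lattice quotient. Then for every polygon P contained in M there is a polygon P' contained in L such that q(P') = P (as sets). -/
theorem poly_incomp {M : Type*} [Lattice M] [Finite M] {x y : M} {C₁ C₂ : Set M}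
    (h : IsPolygonPair (· ≤ ·) x y C₁ C₂) {u v : M} (hu : u ∈ C₁) (hu' : u ∉ C₂)
    (hv : v ∈ C₂) (hv' : v ∉ C₁) : ¬ (u ≤ v ∨ v ≤ u) := by
  intro huv
  obtain ⟨-, h1, h2, -, -, -, hall⟩ := h
  have hch : ({u, v} : Set M) ⊆ IccR (· ≤ ·) x y ∧ IsChain (· ≤ ·) ({u, v} : Set M) := by
    refine ⟨?_, ?_⟩
    · rintro z (rfl | rfl)
      · exact h1.1 hu
      · exact h2.1 hv
    · rintro a (rfl | rfl) b (rfl | rfl) hab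
      · exact absurd rfl hab
      · exact huv
      · exact huv.symm
      · exact absurd rfl hab
  obtain ⟨C, hC, hmax⟩ := (Set.toFinite
    {C : Set M | C ⊆ IccR (· ≤ ·) x y ∧ IsChain (· ≤ ·) C}).exists_le_maximal hch
  have hCm : MaxChainIn (· ≤ ·) (IccR (· ≤ ·) x y) C :=
    ⟨hmax.1.1, hmax.1.2, fun C' a b c => subset_antisymm c (hmax.2 ⟨a, b⟩ c)⟩
  rcases hall C hCm with rfl | rfl
  · exact hv' (hC (by simp))
  · exact hu' (hC (by simp))

theorem poly_atoms {M : Type*} [Lattice M] [Finite M] {x y : M} {C₁ C₂ : Set M}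
    (h : IsPolygonPair (· ≤ ·) x y C₁ C₂) :
    ∃ a b : M, a ≠ b ∧ x ⋖ a ∧ x ⋖ b ∧ a ⊔ b = y := by
  have inc := fun {u v : M} => poly_incomp h (u := u) (v := v)
  obtain ⟨hxy, h1, h2, hne, hun, hint, -⟩ := h
  have mem : ∀ z, z ∈ C₁ → z ∈ C₂ → z = x ∨ z = y := fun z a b => by
    have : z ∈ C₁ ∩ C₂ := ⟨a, b⟩
    rw [hint] at this
    simpa using this
  have hx : x ∈ C₁ ∩ C₂ := by rw [hint]; simp
  have hy : y ∈ C₁ ∩ C₂ := by rw [hint]; simp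
  have hcov : ∀ z, x ≤ z → z ≤ y → z ∈ C₁ ∨ z ∈ C₂ := fun z a b => by
    have : z ∈ IccR (· ≤ ·) x y := ⟨a, b⟩
    rw [hun] at this
    exact this
  obtain ⟨c, hc, hc'⟩ : ∃ c ∈ C₁, c ∉ C₂ := by
    by_contra! hh
    exact hne (h1.2.2 C₂ h2.1 h2.2.1 hh)
  obtain ⟨d, hd, hd'⟩ : ∃ d ∈ C₂, d ∉ C₁ := by
    by_contra! hh
    exact hne (h2.2.2 C₁ h1.1 h1.2.1 hh).symm
  have hxc : x < c := lt_of_le_of_ne (h1.1 hc).1 (by rintro rfl; exact hc' hx.2)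
  have hxd : x < d := lt_of_le_of_ne (h2.1 hd).1 (by rintro rfl; exact hd' hx.1)
  have hcy : c < y := lt_of_le_of_ne (h1.1 hc).2 (by rintro rfl; exact hc' hy.2)
  have hdy : d < y := lt_of_le_of_ne (h2.1 hd).2 (by rintro rfl; exact hd' hy.1)
  obtain ⟨a, hxa, hac⟩ := exists_covBy_le_of_lt hxc
  obtain ⟨b, hxb, hbd⟩ := exists_covBy_le_of_lt hxd
  have key : ∀ z, x < z → z < y → (z ∈ C₁ ∧ z ∉ C₂) ∨ (z ∈ C₂ ∧ z ∉ C₁) := by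
    intro z a b
    have := mem z
    rcases hcov z a.le b.le with h | h
    · exact Or.inl ⟨h, fun h' => (this h h').elim a.ne' b.ne⟩
    · exact Or.inr ⟨h, fun h' => (this h' h).elim a.ne' b.ne⟩
  have ha : a ∈ C₁ ∧ a ∉ C₂ := (key a hxa.lt (hac.trans_lt hcy)).resolve_right
    fun h => inc hc hc' h.1 h.2 (Or.inr hac)
  have hb : b ∈ C₂ ∧ b ∉ C₁ := (key b hxb.lt (hbd.trans_lt hdy)).resolve_left
    fun h => inc h.1 h.2 hd hd' (Or.inl hbd)
  refine ⟨a, b, by rintro rfl; exact ha.2 hb.1, hxa, hxb, ?_⟩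
  by_contra hn
  have hlt : a ⊔ b < y := lt_of_le_of_ne (sup_le (hac.trans hcy.le) (hbd.trans hdy.le)) hn
  rcases key _ (hxa.lt.trans_le le_sup_left) hlt with h | h
  · exact inc h.1 h.2 hb.1 hb.2 (Or.inr le_sup_right)
  · exact inc ha.1 ha.2 h.1 h.2 (Or.inl le_sup_left)

/-- Let `L` be a finite polygonal lattice and `q : L → M` a lattice quotient.
Every polygon of `M` is the image of a polygon of `L`. -/
theorem polygon_lifts {L M : Type*} [Lattice L] [Lattice M]
    [Finite L] [Finite M] (hL : IsPolygonalLattice L)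
    (q : L → M) (hsurj : Function.Surjective q)
    (hsup : ∀ x y : L, q (x ⊔ y) = q x ⊔ q y)
    (hinf : ∀ x y : L, q (x ⊓ y) = q x ⊓ q y)
    (P : Set M) (hP : IsPolygon (· ≤ ·) P) :
    ∃ P' : Set L, IsPolygon (· ≤ ·) P' ∧ q '' P' = P := by
  obtain ⟨x, y, C₁, C₂, rfl, h⟩ := hP
  obtain ⟨a, b, hab, hxa, hxb, rfl⟩ := poly_atoms h
  have hmono : ∀ u v : L, u ≤ v → q u ≤ q v := fun u v huv => by
    rw [← sup_eq_right, ← hsup, sup_eq_right.2 huv]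
  obtain ⟨x0, hx0⟩ := hsurj x
  obtain ⟨x', -, hmax⟩ := (Set.toFinite {z : L | q z = x}).exists_le_maximal hx0
  have hqx : q x' = x := hmax.1
  have hlift : ∀ c, x ⋖ c → ∃ c', x' ⋖ c' ∧ q c' = c := by
    intro c hc
    obtain ⟨z, hz⟩ := hsurj c
    have hqz : q (x' ⊔ z) = c := by rw [hsup, hqx, hz]; exact sup_eq_right.2 hc.le
    have hlt : x' < x' ⊔ z := lt_of_le_of_ne le_sup_left (by
      intro e
      rw [← e, hqx] at hqz
      exact hc.ne hqz)
    obtain ⟨c', hc', hle⟩ := exists_covBy_le_of_lt hlt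
    refine ⟨c', hc', ?_⟩
    have h1 : x ≤ q c' := hqx ▸ hmono _ _ hc'.le
    have h2 : q c' ≤ c := hqz ▸ hmono _ _ hle
    rcases hc.eq_or_eq h1 h2 with e | e
    · exact absurd (hmax.2 (show c' ∈ {z : L | q z = x} from e) hc'.le) hc'.lt.not_ge
    · exact e
  obtain ⟨a', ha', rfl⟩ := hlift a hxa
  obtain ⟨b', hb', rfl⟩ := hlift b hxb
  refine ⟨_, hL.1 x' a' b' (by rintro rfl; exact hab rfl) ha' hb', ?_⟩
  ext z
  constructor
  · rintro ⟨w, ⟨hw1, hw2⟩, rfl⟩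
    exact ⟨hqx ▸ hmono _ _ hw1, hsup a' b' ▸ hmono _ _ hw2⟩
  · rintro ⟨hz1, hz2⟩
    obtain ⟨w, rfl⟩ := hsurj z
    refine ⟨(x' ⊔ w) ⊓ (a' ⊔ b'), ⟨le_inf le_sup_left (ha'.le.trans le_sup_left), inf_le_right⟩, ?_⟩
    rw [hinf, hsup, hsup, hqx, sup_eq_right.2 hz1, inf_eq_left.2 hz2]
end

section
/- Let q : L → M be a lattice quotient of finite lattices, where L is polygonal. Then any two maximal chains of L whose images under q are equal (i.e. which lie in the same fibre of the induced map on maximal chains) are connected by a finite sequence of polygon moves within that fibre. -/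
section Helpers

theorem mc_comp {L : Type*} [PartialOrder L] {C : Set L} (h : IsChain (· ≤ ·) C) {a b : L}
    (ha : a ∈ C) (hb : b ∈ C) : a ≤ b ∨ b ≤ a := by
  by_cases e : a = b
  · exact Or.inl e.le
  · exact h ha hb e

theorem mc_mem {L : Type*} [PartialOrder L] {C : Set L} (h : IsMaxChain (· ≤ ·) C) {z : L}
    (hz : ∀ c ∈ C, z ≤ c ∨ c ≤ z) : z ∈ C := by
  have h1 : IsChain (· ≤ ·) (insert z C) := h.1.insert fun b hb _ => hz b hb
  have h2 := h.2 h1 (Set.subset_insert z C)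
  rw [h2]; exact Set.mem_insert z C

theorem mci_mem {L : Type*} [PartialOrder L] {S C : Set L} (h : MaxChainIn (· ≤ ·) S C) {z : L}
    (hS : z ∈ S) (hz : ∀ c ∈ C, z ≤ c ∨ c ≤ z) : z ∈ C := by
  have h1 : IsChain (· ≤ ·) (insert z C) := h.2.1.insert fun b hb _ => hz b hb
  have h2 := h.2.2 _ (Set.insert_subset hS h.1) h1 (Set.subset_insert z C)
  rw [h2]; exact Set.mem_insert z C

theorem mc_cover {L : Type*} [PartialOrder L] [OrderTop L] [Finite L] {C : Set L}
    (h : IsMaxChain (· ≤ ·) C) {x : L}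
    (hx : x ∈ C) (hne : x ≠ ⊤) : ∃ y ∈ C, x ⋖ y := by
  have ht : (⊤ : L) ∈ C := mc_mem h fun c _ => Or.inr le_top
  obtain ⟨y, hy⟩ := (Set.toFinite {c | c ∈ C ∧ x < c}).exists_minimal
    ⟨⊤, ht, lt_top_iff_ne_top.2 hne⟩
  refine ⟨y, hy.1.1, hy.1.2, fun z hxz hzy => ?_⟩
  have hz : z ∈ C := mc_mem h fun c hc => by
    rcases mc_comp h.1 hc hx with h1 | h1
    · exact Or.inr (h1.trans hxz.le)
    · rcases eq_or_lt_of_le h1 with rfl | h1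
      · exact Or.inr hxz.le
      · rcases mc_comp h.1 hc hy.1.1 with h2 | h2
        · exact Or.inl (hzy.le.trans (hy.2 ⟨hc, h1⟩ h2))
        · exact Or.inl (hzy.le.trans h2)
  exact absurd (hy.2 ⟨hz, hxz⟩ hzy.le) (not_le_of_gt hzy)

theorem q_cover {L M : Type*} [Lattice L] [Lattice M]
    {q : L → M} (hsurj : Function.Surjective q)
    (hsup : ∀ x y : L, q (x ⊔ y) = q x ⊔ q y)
    (hinf : ∀ x y : L, q (x ⊓ y) = q x ⊓ q y) {x y : L} (h : x ⋖ y) {m : M}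
    (h1 : q x ≤ m) (h2 : m ≤ q y) : m = q x ∨ m = q y := by
  obtain ⟨z, rfl⟩ := hsurj m
  have hz : q ((z ⊔ x) ⊓ y) = q z := by
    rw [hinf, hsup, sup_eq_left.2 h1, inf_eq_left.2 h2]
  rcases h.eq_or_eq (le_inf le_sup_right h.le : x ≤ (z ⊔ x) ⊓ y) inf_le_right with e | e
  · left; rw [← hz, e]
  · right; rw [← hz, e]

theorem q_mono {L M : Type*} [Lattice L] [Lattice M] {q : L → M}
    (hsup : ∀ x y : L, q (x ⊔ y) = q x ⊔ q y) {a b : L} (h : a ≤ b) : q a ≤ q b := by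
  have := hsup a b
  rw [sup_eq_right.2 h] at this
  rw [this]; exact le_sup_left

theorem q_chain {L M : Type*} [Lattice L] [Lattice M] {q : L → M}
    (hsup : ∀ x y : L, q (x ⊔ y) = q x ⊔ q y) {C : Set L} (h : IsChain (· ≤ ·) C) :
    IsChain (· ≤ ·) (q '' C) := by
  rintro _ ⟨a, ha, rfl⟩ _ ⟨b, hb, rfl⟩ _
  rcases mc_comp h ha hb with h | h
  · exact Or.inl (q_mono hsup h)
  · exact Or.inr (q_mono hsup h)

theorem q_maxchain {L M : Type*} [Lattice L] [BoundedOrder L] [Finite L] [Lattice M]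
    {q : L → M} (hsurj : Function.Surjective q)
    (hsup : ∀ x y : L, q (x ⊔ y) = q x ⊔ q y)
    (hinf : ∀ x y : L, q (x ⊓ y) = q x ⊓ q y) {C : Set L} (h : IsMaxChain (· ≤ ·) C) :
    IsMaxChain (· ≤ ·) (q '' C) := by
  refine ⟨q_chain hsup h.1, fun D hD hsub => hsub.antisymm fun m hm => ?_⟩
  have hb : (⊥ : L) ∈ C := mc_mem h fun c _ => Or.inl bot_le
  have hqb : q ⊥ ≤ m := by
    obtain ⟨z, rfl⟩ := hsurj m
    exact q_mono hsup bot_le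
  obtain ⟨c, hc⟩ := (Set.toFinite {c | c ∈ C ∧ q c ≤ m}).exists_maximal ⟨⊥, hb, hqb⟩
  by_cases ht : c = ⊤
  · refine ⟨c, hc.1.1, le_antisymm hc.1.2 ?_⟩
    obtain ⟨z, rfl⟩ := hsurj m
    rw [ht]; exact q_mono hsup le_top
  · obtain ⟨y, hy, hcy⟩ := mc_cover h hc.1.1 ht
    have h2 : m ≤ q y := by
      rcases mc_comp hD hm (hsub ⟨y, hy, rfl⟩) with h | h
      · exact h
      · exact absurd (hc.2 ⟨hy, h⟩ hcy.le) (not_le_of_gt hcy.lt)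
    rcases q_cover hsurj hsup hinf hcy hc.1.2 h2 with e | e
    · exact ⟨c, hc.1.1, e.symm⟩
    · exact ⟨y, hy, e.symm⟩

theorem mc_agree {L : Type*} [PartialOrder L] {C E : Set L}
    (hC : IsMaxChain (· ≤ ·) C) (hE : IsMaxChain (· ≤ ·) E) {x y : L} (hxy : x ⋖ y)
    (hxC : x ∈ C) (hyC : y ∈ C) (hyE : y ∈ E) (h : ∀ z ≤ x, z ∈ C → z ∈ E) :
    ∀ z ≤ y, (z ∈ C ↔ z ∈ E) := by
  have hxE := h x le_rfl hxC
  have key : ∀ A : Set L, IsMaxChain (· ≤ ·) A → x ∈ A → ∀ z ∈ A, z ≤ y → z ≤ x ∨ z = y := by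
    intro A hA hxA z hz hzy
    rcases mc_comp hA.1 hz hxA with h | h
    · exact Or.inl h
    · rcases hxy.eq_or_eq h hzy with e | e
      · exact Or.inl e.le
      · exact Or.inr e
  intro z hzy
  constructor
  · intro hz
    rcases key C hC hxC z hz hzy with h1 | rfl
    · exact h z h1 hz
    · exact hyE
  · intro hz
    rcases key E hE hxE z hz hzy with h1 | rfl
    · refine mc_mem hC fun c hc => ?_
      rcases mc_comp hC.1 hc hxC with h2 | h2
      · exact mc_comp hE.1 hz (h c h2 hc)
      · exact Or.inl (h1.trans h2)
    · exact hyC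

theorem pp_mem {L : Type*} [PartialOrder L] {x j : L} {P Q : Set L}
    (h : IsPolygonPair (· ≤ ·) x j P Q) : x ∈ P ∧ x ∈ Q ∧ j ∈ P ∧ j ∈ Q := by
  have h6 := h.2.2.2.2.2.1
  have hx : x ∈ P ∩ Q := by rw [h6]; simp
  have hj : j ∈ P ∩ Q := by rw [h6]; simp
  exact ⟨hx.1, hx.2, hj.1, hj.2⟩

theorem pp_symm {L : Type*} [PartialOrder L] {x j : L} {P Q : Set L}
    (h : IsPolygonPair (· ≤ ·) x j P Q) : IsPolygonPair (· ≤ ·) x j Q P := by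
  obtain ⟨h1, h2, h3, h4, h5, h6, h7⟩ := h
  exact ⟨h1, h3, h2, h4.symm, by rw [h5, Set.union_comm], by rw [Set.inter_comm, h6],
    fun C hC => (h7 C hC).symm⟩

theorem mc_out {L : Type*} [PartialOrder L] {x j : L} {P Q E : Set L}
    (h : IsPolygonPair (· ≤ ·) x j P Q) (hE : IsMaxChain (· ≤ ·) E) (hP : P ⊆ E) {z : L}
    (hz : z ∈ E) (hzP : z ∉ P) : z < x ∨ j < z := by
  obtain ⟨hx, _, hj, _⟩ := pp_mem h
  rcases mc_comp hE.1 hz (hP hx) with h1 | h1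
  · exact Or.inl (lt_of_le_of_ne h1 fun e => hzP (e ▸ hx))
  rcases mc_comp hE.1 hz (hP hj) with h2 | h2
  · exact absurd (mci_mem h.2.1 ⟨h1, h2⟩ fun c hc => mc_comp hE.1 hz (hP hc)) hzP
  · exact Or.inr (lt_of_le_of_ne h2 fun e => hzP (e ▸ hj))

theorem mc_move {L : Type*} [PartialOrder L] {x j : L} {P Q E : Set L}
    (h : IsPolygonPair (· ≤ ·) x j P Q) (hE : IsMaxChain (· ≤ ·) E) (hP : P ⊆ E) :
    IsMaxChain (· ≤ ·) ((E \ P) ∪ Q) ∧ PolygonMove (· ≤ ·) E ((E \ P) ∪ Q) := by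
  obtain ⟨hxP, hxQ, hjP, hjQ⟩ := pp_mem h
  have hcmp : ∀ a ∈ E \ P, ∀ b ∈ IccR (· ≤ ·) x j, a ≤ b ∨ b ≤ a := by
    intro a ha b hb
    rcases mc_out h hE hP ha.1 ha.2 with h1 | h1
    · exact Or.inl (h1.le.trans hb.1)
    · exact Or.inr (hb.2.trans h1.le)
  constructor
  · constructor
    · rintro a (ha | ha) b (hb | hb) _
      · exact mc_comp hE.1 ha.1 hb.1
      · exact hcmp a ha b (h.2.2.1.1 hb)
      · exact (hcmp b hb a (h.2.2.1.1 ha)).symm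
      · exact mc_comp h.2.2.1.2.1 ha hb
    · intro D hD hsub
      refine hsub.antisymm fun z hz => ?_
      have hc : ∀ c ∈ (E \ P) ∪ Q, z ≤ c ∨ c ≤ z := fun c hc => mc_comp hD hz (hsub hc)
      have fin : (∀ c ∈ P, z ≤ c ∨ c ≤ z) → (z ∈ P → z ∈ Q) → z ∈ (E \ P) ∪ Q := by
        intro h1 h2
        by_cases hzP : z ∈ P
        · exact Or.inr (h2 hzP)
        · refine Or.inl ⟨mc_mem hE fun c hcE => ?_, hzP⟩
          by_cases hcP : c ∈ P
          · exact h1 c hcP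
          · exact hc c (Or.inl ⟨hcE, hcP⟩)
      rcases hc x (Or.inr hxQ) with h1 | h1
      · refine fin (fun c hc => Or.inl (h1.trans (h.2.1.1 hc).1)) fun hzP => ?_
        rw [le_antisymm h1 (h.2.1.1 hzP).1]; exact hxQ
      rcases hc j (Or.inr hjQ) with h2 | h2
      · exact Or.inr (mci_mem h.2.2.1 ⟨h1, h2⟩ fun c hcQ => hc c (Or.inr hcQ))
      · refine fin (fun c hc => Or.inr ((h.2.1.1 hc).2.trans h2)) fun hzP => ?_
        rw [le_antisymm (h.2.1.1 hzP).2 h2]; exact hjQ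
  · refine ⟨x, j, P, Q, h, hP, Set.subset_union_right, ?_⟩
    ext z
    constructor
    · rintro ⟨hzE, hzP⟩
      refine ⟨Or.inl ⟨hzE, hzP⟩, fun hzQ => ?_⟩
      have hI := h.2.2.1.1 hzQ
      rcases mc_out h hE hP hzE hzP with h1 | h1
      · exact absurd hI.1 (not_le_of_gt h1)
      · exact absurd hI.2 (not_le_of_gt h1)
    · rintro ⟨hz | hz, hzQ⟩
      · exact hz
      · exact absurd hz hzQ

theorem poly_of {L : Type*} [Lattice L] (hL : IsPolygonalLattice L) {x y₁ y₂ : L}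
    (hne : y₁ ≠ y₂) (h1 : x ⋖ y₁) (h2 : x ⋖ y₂) :
    ∃ P Q, IsPolygonPair (· ≤ ·) x (y₁ ⊔ y₂) P Q ∧ y₁ ∈ P ∧ y₂ ∈ Q := by
  obtain ⟨a, b, P, Q, hI, h⟩ := hL.1 x y₁ y₂ hne h1 h2
  have hab : a ≤ b := h.1
  have hxj : x ≤ y₁ ⊔ y₂ := h1.le.trans le_sup_left
  have e1 : a ∈ IccR (· ≤ ·) x (y₁ ⊔ y₂) := by rw [hI]; exact ⟨le_rfl, hab⟩
  have e2 : b ∈ IccR (· ≤ ·) x (y₁ ⊔ y₂) := by rw [hI]; exact ⟨hab, le_rfl⟩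
  have e3 : x ∈ IccR (· ≤ ·) a b := by rw [← hI]; exact ⟨le_rfl, hxj⟩
  have e4 : y₁ ⊔ y₂ ∈ IccR (· ≤ ·) a b := by rw [← hI]; exact ⟨hxj, le_rfl⟩
  obtain rfl : x = a := le_antisymm e1.1 e3.1
  obtain rfl : y₁ ⊔ y₂ = b := le_antisymm e4.2 e2.2
  have hu := h.2.2.2.2.1
  have m1 : y₁ ∈ P ∪ Q := by rw [← hu]; exact ⟨h1.le, le_sup_left⟩
  have m2 : y₂ ∈ P ∪ Q := by rw [← hu]; exact ⟨h2.le, le_sup_right⟩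
  have inc : ¬ (y₁ ≤ y₂ ∨ y₂ ≤ y₁) := by
    rintro (h | h)
    · rcases h2.eq_or_eq h1.le h with e | e
      · exact h1.ne e.symm
      · exact hne e
    · rcases h1.eq_or_eq h2.le h with e | e
      · exact h2.ne e.symm
      · exact hne e.symm
  rcases m1 with m1 | m1 <;> rcases m2 with m2 | m2
  · exact absurd (mc_comp h.2.1.2.1 m1 m2) inc
  · exact ⟨P, Q, h, m1, m2⟩
  · exact ⟨Q, P, pp_symm h, m1, m2⟩
  · exact absurd (mc_comp h.2.2.1.2.1 m1 m2) inc

theorem fibre_aux {L M : Type*} [Lattice L] [BoundedOrder L] [Lattice M]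
    [Finite L] (hL : IsPolygonalLattice L)
    (q : L → M) (hsurj : Function.Surjective q)
    (hsup : ∀ x y : L, q (x ⊔ y) = q x ⊔ q y)
    (hinf : ∀ x y : L, q (x ⊓ y) = q x ⊓ q y) (D : Set M) (x : L) :
    ∀ (C C' : Set L), IsMaxChain (· ≤ ·) C → IsMaxChain (· ≤ ·) C' →
    q '' C = D → q '' C' = D → x ∈ C → x ∈ C' → (∀ z ≤ x, (z ∈ C ↔ z ∈ C')) →
    Relation.ReflTransGen
      (fun A B => PolygonMove (· ≤ ·) A B ∧ IsMaxChain (· ≤ ·) B ∧ q '' B = D)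
      C C' := by
  induction x using WellFoundedGT.induction with
  | ind x ih =>
  intro C C' hC hC' hD hD' hxC hxC' hag
  by_cases ht : x = ⊤
  · have : C = C' := by ext z; exact hag z (ht ▸ le_top)
    rw [this]
  obtain ⟨y₁, hy₁, hc₁⟩ := mc_cover hC hxC ht
  obtain ⟨y₂, hy₂, hc₂⟩ := mc_cover hC' hxC' ht
  by_cases hne : y₁ = y₂
  · subst hne
    exact ih y₁ hc₁.lt C C' hC hC' hD hD' hy₁ hy₂
      (mc_agree hC hC' hc₁ hxC hy₁ hy₂ fun z hz h => (hag z hz).1 h)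
  obtain ⟨P, Q, hPQ, m1, m2⟩ := poly_of hL hne hc₁ hc₂
  obtain ⟨hxP, hxQ, hjP, hjQ⟩ := pp_mem hPQ
  set j := y₁ ⊔ y₂ with hj
  have hxj : x ≤ j := hPQ.1
  -- the starting chain
  have hch : IsChain (· ≤ ·) ((C ∩ Set.Iic x) ∪ P ∪ ((fun c => c ⊔ j) '' C)) := by
    have lo : ∀ a ∈ C ∩ Set.Iic x, ∀ b ∈ P, a ≤ b := fun a ha b hb =>
      le_trans ha.2 (hPQ.2.1.1 hb).1
    have hi : ∀ a ∈ P, ∀ b ∈ (fun c => c ⊔ j) '' C, a ≤ b := by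
      rintro a ha _ ⟨c, _, rfl⟩
      exact le_trans (hPQ.2.1.1 ha).2 le_sup_right
    rintro a ((ha | ha) | ha) b ((hb | hb) | hb) _
    · exact mc_comp hC.1 ha.1 hb.1
    · exact Or.inl (lo a ha b hb)
    · exact Or.inl ((lo a ha x hxP).trans (hi x hxP b hb))
    · exact Or.inr (lo b hb a ha)
    · exact mc_comp hPQ.2.1.2.1 ha hb
    · exact Or.inl (hi a ha b hb)
    · exact Or.inr ((lo b hb x hxP).trans (hi x hxP a ha))
    · exact Or.inr (hi b hb a ha)
    · obtain ⟨c, hc, rfl⟩ := ha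
      obtain ⟨d, hd, rfl⟩ := hb
      rcases mc_comp hC.1 hc hd with h | h
      · exact Or.inl (sup_le_sup_right h j)
      · exact Or.inr (sup_le_sup_right h j)
  obtain ⟨E, hE, hsub⟩ := hch.exists_maxChain
  have hPE : P ⊆ E := fun z hz => hsub (Or.inl (Or.inr hz))
  obtain ⟨hE2, hmove⟩ := mc_move hPQ hE hPE
  set E' := (E \ P) ∪ Q with hE'
  have hDmax : IsMaxChain (· ≤ ·) D := hD ▸ q_maxchain hsurj hsup hinf hC
  -- images
  have himg : ∀ F : Set L, IsMaxChain (· ≤ ·) F → (∀ z ≤ x, z ∈ C → z ∈ F) → j ∈ F →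
      (∀ c ∈ C, c ⊔ j ∈ F) → q '' F = D := by
    intro F hF hlo hjF hup
    refine (hDmax.2 (q_chain hsup hF.1) ?_).symm
    rw [← hD]
    rintro _ ⟨c, hc, rfl⟩
    rcases mc_comp hC.1 hc hxC with h | h
    · exact ⟨c, hlo c h hc, rfl⟩
    have d1 : q y₁ ∈ D := hD ▸ ⟨y₁, hy₁, rfl⟩
    have d2 : q y₂ ∈ D := hD' ▸ ⟨y₂, hy₂, rfl⟩
    have dj : ∃ y, x ⋖ y ∧ q j = q y ∧ q j ∈ D := by
      rcases mc_comp hDmax.1 d1 d2 with h | h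
      · have : q j = q y₂ := by rw [hj, hsup, sup_eq_right.2 h]
        exact ⟨y₂, hc₂, this, this ▸ d2⟩
      · have : q j = q y₁ := by rw [hj, hsup, sup_eq_left.2 h]
        exact ⟨y₁, hc₁, this, this ▸ d1⟩
    obtain ⟨y, hxy, ey, djD⟩ := dj
    rcases mc_comp hDmax.1 djD (hD ▸ ⟨c, hc, rfl⟩ : q c ∈ D) with h1 | h1
    · exact ⟨c ⊔ j, hup c hc, by rw [hsup, sup_eq_left.2 h1]⟩
    · rcases q_cover hsurj hsup hinf hxy (q_mono hsup h) (ey ▸ h1) with e | e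
      · exact ⟨x, hlo x le_rfl hxC, e.symm⟩
      · exact ⟨j, hjF, by rw [e, ey]⟩
  have hloE : ∀ z ≤ x, z ∈ C → z ∈ E := fun z hz h => hsub (Or.inl (Or.inl ⟨h, hz⟩))
  have hupE : ∀ c ∈ C, c ⊔ j ∈ E := fun c hc => hsub (Or.inr ⟨c, hc, rfl⟩)
  have hloE' : ∀ z ≤ x, z ∈ C → z ∈ E' := by
    intro z hz h
    by_cases hzP : z ∈ P
    · rw [le_antisymm hz (hPQ.2.1.1 hzP).1]; exact Or.inr hxQ
    · exact Or.inl ⟨hloE z hz h, hzP⟩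
  have hupE' : ∀ c ∈ C, c ⊔ j ∈ E' := by
    intro c hc
    by_cases hzP : c ⊔ j ∈ P
    · rw [le_antisymm (hPQ.2.1.1 hzP).2 le_sup_right]; exact Or.inr hjQ
    · exact Or.inl ⟨hupE c hc, hzP⟩
  have iE : q '' E = D := himg E hE hloE (hPE hjP) hupE
  have iE' : q '' E' = D := himg E' hE2 hloE' (Or.inr hjQ) hupE'
  have s1 := ih y₁ hc₁.lt C E hC hE hD iE hy₁ (hPE m1)
    (mc_agree hC hE hc₁ hxC hy₁ (hPE m1) hloE)
  have hy₂E' : y₂ ∈ E' := Or.inr m2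
  have s3 := ih y₂ hc₂.lt E' C' hE2 hC' iE' hD' hy₂E' hy₂
    (fun z hz => (mc_agree hC' hE2 hc₂ hxC' hy₂ hy₂E'
      (fun z hz h => hloE' z hz ((hag z hz).2 h)) z hz).symm)
  exact (s1.tail ⟨hmove, hE2, iE'⟩).trans s3

end Helpers

/-- Let `q : L → M` be a lattice quotient of finite lattices, with `L` polygonal.
Any two maximal chains of `L` with the same image in `M` are connected by a
finite sequence of polygon moves within that fibre of the induced map on
maximal chains. -/
theorem fibre_connected_by_polygon_moves {L M : Type*} [Lattice L] [Lattice M]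
    [Finite L] [Finite M] (hL : IsPolygonalLattice L)
    (q : L → M) (hsurj : Function.Surjective q)
    (hsup : ∀ x y : L, q (x ⊔ y) = q x ⊔ q y)
    (hinf : ∀ x y : L, q (x ⊓ y) = q x ⊓ q y)
    (C C' : Set L) (hC : IsMaxChain (· ≤ ·) C) (hC' : IsMaxChain (· ≤ ·) C')
    (him : q '' C = q '' C') :
    Relation.ReflTransGen
      (fun A B => PolygonMove (· ≤ ·) A B ∧ IsMaxChain (· ≤ ·) B ∧ q '' B = q '' C)
      C C' := by
  classical
  rcases isEmpty_or_nonempty L with hempty | hnon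
  · have : C = C' := by ext z; exact hempty.elim z
    rw [this]
  · have : Fintype L := Fintype.ofFinite L
    letI : BoundedOrder L := Fintype.toBoundedOrder L
    have b1 : (⊥ : L) ∈ C := mc_mem hC fun c _ => Or.inl bot_le
    have b2 : (⊥ : L) ∈ C' := mc_mem hC' fun c _ => Or.inl bot_le
    refine fibre_aux hL q hsurj hsup hinf (q '' C) ⊥ C C' hC hC' rfl him.symm b1 b2 ?_
    intro z hz
    rw [le_bot_iff.1 hz]
    exact ⟨fun _ => b2, fun _ => b1⟩
end

section
/- Let L be a finite polygonal lattice with θ a lattice congruence on L and λ : CovRel(L) → E a forcing-consistent edge labelling. If [x] ⋖ [y] is a covering relation in the quotient lattice L/θ, then λ(x', y') is constant over all covering relations x' ⋖ y' of L with x' ∈ [x] and y' ∈ [y]. In particular the quotient edge labelling λ_θ : CovRel(L/θ) → E, λ_θ([x],[y]) = λ(x', y'), is well defined. -/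
/-- Let `L` be a finite polygonal lattice with a forcing-consistent edge labelling
`lab`, and let `q : L → M` realise a lattice congruence `θ` on `L` as a
lattice quotient (so the `θ`-classes are the fibres of `q`).  If
`q x ⋖ q y` is a covering relation of the quotient lattice, then the label
`lab x' y'` is constant over all covering relations `x' ⋖ y'` of `L` with
`x'` in the fibre of `q x` and `y'` in the fibre of `q y`.  In particular the
quotient edge labelling is well defined. -/
theorem quotient_labels_constant {L M E : Type*} [Lattice L] [Lattice M]
    [Finite L] [Finite M]
    (hL : IsPolygonalLattice L) (lab : L → L → E)
    (hfc : ForcingConsistent lab)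
    (q : L → M) (hsurj : Function.Surjective q)
    (hsup : ∀ x y : L, q (x ⊔ y) = q x ⊔ q y)
    (hinf : ∀ x y : L, q (x ⊓ y) = q x ⊓ q y)
    (x y : L) (hcov : q x ⋖ q y)
    (x₁ y₁ x₂ y₂ : L) (h₁ : x₁ ⋖ y₁) (h₂ : x₂ ⋖ y₂)
    (e₁ : q x₁ = q x) (e₂ : q y₁ = q y) (e₃ : q x₂ = q x) (e₄ : q y₂ = q y) :
    lab x₁ y₁ = lab x₂ y₂ := by
  have hle : q x ≤ q y := hcov.le
  have hmono : ∀ a b : L, a ≤ b → q a ≤ q b := by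
    intro a b h
    have := hsup a b
    rw [sup_eq_right.mpr h] at this
    rw [this]; exact le_sup_left
  -- least element of the class of y
  obtain ⟨m, hm, hmin⟩ : ∃ m, q m = q y ∧ ∀ z, q z = q y → m ≤ z := by
    obtain ⟨m, hm⟩ := (Set.toFinite {z : L | q z = q y}).exists_minimal ⟨y, rfl⟩
    refine ⟨m, hm.1, fun z hz => ?_⟩
    have h1 : q (m ⊓ z) = q y := by rw [hinf, hm.1, hz, inf_idem]
    exact (hm.2 h1 inf_le_left).trans inf_le_right
  -- greatest element of the class of x
  obtain ⟨t, ht, hmax⟩ : ∃ t, q t = q x ∧ ∀ z, q z = q x → z ≤ t := by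
    obtain ⟨t, ht⟩ := (Set.toFinite {z : L | q z = q x}).exists_maximal ⟨x, rfl⟩
    refine ⟨t, ht.1, fun z hz => ?_⟩
    have h1 : q (t ⊔ z) = q x := by rw [hsup, ht.1, hz, sup_idem]
    exact le_sup_right.trans (ht.2 h1 le_sup_left)
  have hp : q (m ⊓ t) = q x := by rw [hinf, hm, ht, inf_eq_right.mpr hle]
  have hpm : m ⊓ t ⋖ m := by
    refine ⟨lt_of_le_of_ne inf_le_left ?_, ?_⟩
    · intro h
      rw [h, hm] at hp
      exact hcov.ne hp.symm
    · intro z h1 h2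
      have a1 : q x ≤ q z := hp ▸ hmono _ _ h1.le
      have a2 : q z ≤ q y := hm ▸ hmono _ _ h2.le
      rcases hcov.eq_or_eq a1 a2 with h | h
      · exact absurd (le_inf h2.le (hmax z h)) (not_le_of_gt h1)
      · exact absurd (hmin z h) (not_le_of_gt h2)
  have key : ∀ a b : L, a ⋖ b → q a = q x → q b = q y → lab a b = lab (m ⊓ t) m := by
    intro a b hab ha hb
    have hmb : m ≤ b := hmin b hb
    have hma : ¬ m ≤ a := by
      intro h
      have := hmono _ _ h
      rw [hm, ha] at this
      exact absurd this (not_le_of_gt hcov.lt)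
    have hpa : m ⊓ t ≤ a := by
      have h1 : q (a ⊔ m ⊓ t) = q x := by rw [hsup, ha, hp, sup_idem]
      rcases hab.eq_or_eq (c := a ⊔ m ⊓ t) le_sup_left
        (sup_le hab.le (inf_le_left.trans hmb)) with h | h
      · exact sup_eq_left.mp h
      · rw [h, hb] at h1
        exact absurd h1.symm hcov.ne
    have hj : m ⊔ a = b := by
      rcases hab.eq_or_eq (c := m ⊔ a) le_sup_right (sup_le hmb hab.le) with h | h
      · exact absurd (sup_eq_right.mp h) hma
      · exact h
    have hi : a ⊓ m = m ⊓ t := by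
      rcases hpm.eq_or_eq (c := a ⊓ m) (le_inf hpa inf_le_left) inf_le_right with h | h
      · exact h
      · exact absurd (inf_eq_right.mp h) hma
    refine hfc _ _ _ _ hab hpm ⟨fun θ hθ h => ?_, fun θ hθ h => ?_⟩
    · have := (hθ.2 _ _ m h).2
      rwa [hi, inf_eq_right.mpr hmb] at this
    · have := (hθ.2 _ _ a h).1
      rwa [hj, sup_eq_right.mpr hpa] at this
  rw [key _ _ h₁ e₁ e₂, key _ _ h₂ e₃ e₄]
end

section
/- Let L be a finite polygonal lattice with λ : CovRel(L) → E a forcing-consistent edge labelling and θ a lattice congruence on L. Then the quotient edge labelling λ_θ : CovRel(L/θ) → E is also forcing-consistent. -/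
theorem aux_lift_cover {L M : Type*} [Lattice L] [Lattice M] [Finite L]
    (q : L → M) (hsurj : Function.Surjective q)
    (hsup : ∀ x y : L, q (x ⊔ y) = q x ⊔ q y) {a b : M} (hab : a ⋖ b) :
    ∃ x y : L, x ⋖ y ∧ q x = a ∧ q y = b := by
  have hmono : ∀ x y : L, x ≤ y → q x ≤ q y := by
    intro x y h
    have := hsup x y
    rw [sup_eq_right.mpr h] at this
    rw [this]; exact le_sup_left
  obtain ⟨x0, hx0⟩ := hsurj a
  obtain ⟨y0, hy0⟩ := hsurj b
  have hY : q (x0 ⊔ y0) = b := by rw [hsup, hx0, hy0]; exact sup_eq_right.mpr hab.le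
  obtain ⟨x, hx⟩ := (Set.toFinite {x : L | x ≤ x0 ⊔ y0 ∧ q x = a}).exists_maximal
    ⟨x0, le_sup_left, hx0⟩
  have hxY : x < x0 ⊔ y0 := lt_of_le_of_ne hx.prop.1 (by
    intro h
    have h2 := hx.prop.2
    rw [h, hY] at h2
    exact hab.ne h2.symm)
  obtain ⟨y, hxy, hyY⟩ := exists_covBy_le_of_lt hxY
  refine ⟨x, y, hxy, hx.prop.2, ?_⟩
  have h1 : a ≤ q y := by rw [← hx.prop.2]; exact hmono _ _ hxy.le
  have h2 : q y ≤ b := by rw [← hY]; exact hmono _ _ hyY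
  rcases hab.eq_or_eq h1 h2 with h | h
  · exact absurd (hx.le_of_ge ⟨hyY, h⟩ hxy.le) hxy.lt.not_ge
  · exact h

theorem aux_eqvGen_cover {L : Type*} [Lattice L] {x y : L} (hxy : x ⋖ y)
    (R : L → L → Prop) (hR : ∀ u v, R u v → R v u)
    (hRp : ∀ u v, R u v → R ((u ⊔ x) ⊓ y) ((v ⊔ x) ⊓ y))
    (h : Relation.EqvGen R x y) : R x y := by
  by_contra hn
  have key : ∀ u v, Relation.EqvGen R u v → (u ⊔ x) ⊓ y = (v ⊔ x) ⊓ y := by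
    intro u v h
    induction h with
    | rel u v h =>
      have h3 := hRp u v h
      rcases hxy.eq_or_eq (le_inf le_sup_right hxy.le : x ≤ (u ⊔ x) ⊓ y) inf_le_right with h1 | h1 <;>
      rcases hxy.eq_or_eq (le_inf le_sup_right hxy.le : x ≤ (v ⊔ x) ⊓ y) inf_le_right with h2 | h2 <;>
      rw [h1, h2] at h3 ⊢
      · exact absurd h3 hn
      · exact absurd (hR _ _ h3) hn
    | refl => rfl
    | symm _ _ _ ih => exact ih.symm
    | trans _ _ _ _ _ ih1 ih2 => exact ih1.trans ih2
  have := key x y h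
  rw [sup_idem, inf_eq_left.mpr hxy.le, sup_eq_left.mpr hxy.le, inf_idem] at this
  exact hxy.ne this

theorem aux_forces {L M : Type*} [Lattice L] [Lattice M]
    (q : L → M) (hsurj : Function.Surjective q)
    (hsup : ∀ x y : L, q (x ⊔ y) = q x ⊔ q y)
    (hinf : ∀ x y : L, q (x ⊓ y) = q x ⊓ q y) {x y z w : L}
    (hzw : z ⋖ w) (hq : q z ≠ q w) (hF : Forces (q x) (q y) (q z) (q w)) :
    Forces x y z w := by
  intro α hα hxy
  let R : L → L → Prop := fun u v => α u v ∨ q u = q v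
  have hR : ∀ u v, R u v → R v u := fun u v h => h.imp hα.1.symm Eq.symm
  have hRs : ∀ u v t, R u v → R (u ⊔ t) (v ⊔ t) := fun u v t h =>
    h.imp (fun h => (hα.2 _ _ t h).1) (fun h => by rw [hsup, hsup, h])
  have hRi : ∀ u v t, R u v → R (u ⊓ t) (v ⊓ t) := fun u v t h =>
    h.imp (fun h => (hα.2 _ _ t h).2) (fun h => by rw [hinf, hinf, h])
  have hG : ∀ f : L → L, (∀ u v, R u v → R (f u) (f v)) → ∀ u v,
      Relation.EqvGen R u v → Relation.EqvGen R (f u) (f v) := by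
    intro f hf u v h
    induction h with
    | rel u v h => exact .rel _ _ (hf _ _ h)
    | refl => exact .refl _
    | symm _ _ _ ih => exact ih.symm
    | trans _ _ _ _ _ ih1 ih2 => exact ih1.trans _ _ _ ih2
  have hcong : IsLatticeCongruence
      (fun m n : M => ∀ u v, q u = m → q v = n → Relation.EqvGen R u v) := by
    refine ⟨⟨?_, ?_, ?_⟩, ?_⟩
    · intro m u v hu hv
      exact .rel _ _ (Or.inr (hu.trans hv.symm))
    · intro m n h u v hu hv
      exact (h v u hv hu).symm
    · intro m n p h1 h2 u v hu hv
      obtain ⟨t, ht⟩ := hsurj n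
      exact (h1 u t hu ht).trans _ _ _ (h2 t v ht hv)
    · intro m n p h
      obtain ⟨m, rfl⟩ := hsurj m
      obtain ⟨n, rfl⟩ := hsurj n
      obtain ⟨p, rfl⟩ := hsurj p
      have h0 := h m n rfl rfl
      constructor
      · intro u v hu hv
        have h1 := hG (fun t => t ⊔ p) (fun u v => hRs u v p) _ _ h0
        refine .trans _ _ _ (.rel _ _ (Or.inr ?_)) (.trans _ _ _ h1 (.rel _ _ (Or.inr ?_)))
        · rw [hu, hsup]
        · rw [hv, hsup]
      · intro u v hu hv
        have h1 := hG (fun t => t ⊓ p) (fun u v => hRi u v p) _ _ h0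
        refine .trans _ _ _ (.rel _ _ (Or.inr ?_)) (.trans _ _ _ h1 (.rel _ _ (Or.inr ?_)))
        · rw [hu, hinf]
        · rw [hv, hinf]
  have hgen : Relation.EqvGen R z w := hF _ hcong (by
    intro u v hu hv
    exact .trans _ _ _ (.rel _ _ (Or.inr hu)) (.trans _ _ _ (.rel _ _ (Or.inl hxy))
      (.rel _ _ (Or.inr hv.symm)))) z w rfl rfl
  rcases aux_eqvGen_cover hzw R hR (fun u v h => hRi _ _ w (hRs _ _ z h)) hgen with h | h
  · exact h
  · exact absurd h hq

/-- Let `L` be a finite polygonal lattice with `lab` a forcing-consistent edge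
labelling, and let `q : L → M` realise a lattice congruence on `L` as a
lattice quotient.  Then the quotient edge labelling `lab'` (characterised by
`lab' (q x) (q y) = lab x y` whenever `x ⋖ y` in `L` and `q x ⋖ q y` in `M`)
is also forcing-consistent. -/
theorem quotient_labelling_forcing_consistent {L M E : Type*} [Lattice L]
    [Lattice M] [Finite L] [Finite M]
    (hL : IsPolygonalLattice L) (lab : L → L → E)
    (hfc : ForcingConsistent lab)
    (q : L → M) (hsurj : Function.Surjective q)
    (hsup : ∀ x y : L, q (x ⊔ y) = q x ⊔ q y)
    (hinf : ∀ x y : L, q (x ⊓ y) = q x ⊓ q y)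
    (lab' : M → M → E)
    (hcompat : ∀ x y : L, x ⋖ y → q x ⋖ q y → lab' (q x) (q y) = lab x y) :
    ForcingConsistent lab' := by
  intro a b c d hab hcd hF
  obtain ⟨x, y, hxy, rfl, rfl⟩ := aux_lift_cover q hsurj hsup hab
  obtain ⟨z, w, hzw, rfl, rfl⟩ := aux_lift_cover q hsurj hsup hcd
  rw [hcompat x y hxy hab, hcompat z w hzw hcd]
  exact hfc x y z w hxy hzw ⟨aux_forces q hsurj hsup hinf hzw hcd.ne hF.1,
    aux_forces q hsurj hsup hinf hxy hab.ne hF.2⟩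
end

section
/- Let L be a finite polygonal lattice with λ : CovRel(L) → E a forcing-consistent edge labelling valued in a finite poset E, and θ a lattice congruence on L. If λ is polygonal, then the quotient edge labelling λ_θ on the quotient lattice L/θ is polygonal as well. -/
section Helpers

theorem hp_symm {α : Type*} {r : α → α → Prop} {x y : α} {C D : Set α}
    (h : IsPolygonPair r x y C D) : IsPolygonPair r x y D C := by
  obtain ⟨h1, h2, h3, h4, h5, h6, h7⟩ := h
  exact ⟨h1, h3, h2, h4.symm, by rw [h5, Set.union_comm], by rw [Set.inter_comm, h6],
    fun C hC => (h7 C hC).symm⟩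

theorem hp_cov {α : Type*} [PartialOrder α] {a b : α} :
    CovR (α := α) (· ≤ ·) a b ↔ a ⋖ b := by
  constructor
  · rintro ⟨h1, h2, h3⟩
    refine ⟨lt_of_le_of_ne h1 h2, fun c hc hd => ?_⟩
    rcases h3 c hc.le hd.le with h | h
    · exact hc.ne h.symm
    · exact hd.ne h
  · intro h
    exact ⟨h.le, h.ne, fun z h1 h2 => h.eq_or_eq h1 h2⟩

theorem hp_ext {α : Type*} [PartialOrder α] [Finite α] {S c : Set α}
    (hc : c ⊆ S) (hch : IsChain (· ≤ ·) c) :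
    ∃ C, MaxChainIn (α := α) (· ≤ ·) S C ∧ c ⊆ C := by
  obtain ⟨C, hle, hC⟩ := (Set.toFinite {C : Set α | C ⊆ S ∧ IsChain (· ≤ ·) C}).exists_le_maximal
    (a := c) ⟨hc, hch⟩
  exact ⟨C, ⟨hC.prop.1, hC.prop.2, fun C' h1 h2 h3 =>
    Set.Subset.antisymm h3 (hC.le_of_ge ⟨h1, h2⟩ h3)⟩, hle⟩

theorem hp_inc {α : Type*} [PartialOrder α] [Finite α] {x y : α} {C D : Set α}
    (h : IsPolygonPair (α := α) (· ≤ ·) x y C D) {u v : α} (hu : u ∈ C) (hv : v ∈ D)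
    (hux : u ≠ x) (huy : u ≠ y) (hvx : v ≠ x) (hvy : v ≠ y) : ¬ (u ≤ v ∨ v ≤ u) := by
  intro huv
  obtain ⟨h1, h2, h3, h4, h5, h6, h7⟩ := h
  have huD : u ∉ D := fun hh => by
    have : u ∈ C ∩ D := ⟨hu, hh⟩
    rw [h6] at this
    rcases this with h | h
    · exact hux h
    · exact huy h
  have hvC : v ∉ C := fun hh => by
    have : v ∈ C ∩ D := ⟨hh, hv⟩
    rw [h6] at this
    rcases this with h | h
    · exact hvx h
    · exact hvy h
  obtain ⟨B, hB, hsub⟩ := hp_ext (S := IccR (· ≤ ·) x y) (c := {u, v})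
    (by
      rintro z (rfl | hz)
      · exact h2.1 hu
      · rw [Set.mem_singleton_iff] at hz
        subst hz
        exact h3.1 hv)
    (by
      rintro a (rfl | ha) b (rfl | hb) hab <;> simp_all <;> tauto)
  rcases h7 B hB with rfl | rfl
  · exact hvC (hsub (by simp))
  · exact huD (hsub (by simp))

theorem hp_ends {α : Type*} {r : α → α → Prop} {x y : α} {C D : Set α}
    (h : IsPolygonPair r x y C D) : x ∈ C ∧ y ∈ C := by
  have h6 := h.2.2.2.2.2.1
  have hx : x ∈ C ∩ D := by rw [h6]; simp
  have hy : y ∈ C ∩ D := by rw [h6]; simp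
  exact ⟨hx.1, hy.1⟩

theorem hp_interior {α : Type*} [PartialOrder α] {x y : α} {C D : Set α}
    (h : IsPolygonPair (α := α) (· ≤ ·) x y C D) : ∃ u ∈ C, u ≠ x ∧ u ≠ y := by
  by_contra hcon
  push Not at hcon
  have e := hp_ends (hp_symm h)
  obtain ⟨h1, h2, h3, h4, h5, h6, h7⟩ := h
  refine h4 (h2.2.2 D h3.1 h3.2.1 fun u hu => ?_)
  by_cases hux : u = x
  · subst hux; exact e.1
  · rw [hcon u hu hux]; exact e.2

theorem hp_atom {α : Type*} [PartialOrder α] [Finite α] {x y : α} {C D : Set α}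
    (h : IsPolygonPair (α := α) (· ≤ ·) x y C D) : ∃ a ∈ C, x ⋖ a ∧ a ≠ y := by
  obtain ⟨u, hu, hux, huy⟩ := hp_interior h
  have huI := h.2.1.1 hu
  obtain ⟨a, hxa, hau⟩ := exists_covBy_le_of_lt (lt_of_le_of_ne huI.1 hux.symm)
  have hay : a ≠ y := fun e => huy (le_antisymm huI.2 (e ▸ hau))
  refine ⟨a, ?_, hxa, hay⟩
  have haI : a ∈ IccR (α := α) (· ≤ ·) x y := ⟨hxa.le, hau.trans huI.2⟩
  rw [h.2.2.2.2.1] at haI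
  rcases haI with haI | haI
  · exact haI
  · exact absurd (Or.inr hau) (hp_inc h hu haI hux huy hxa.ne' hay)

theorem hp_join {α : Type*} [Lattice α] [Finite α] {x y : α} {C D : Set α}
    (h : IsPolygonPair (α := α) (· ≤ ·) x y C D) {u v : α} (hu : u ∈ C) (hv : v ∈ D)
    (hux : u ≠ x) (huy : u ≠ y) (hvx : v ≠ x) (hvy : v ≠ y) : u ⊔ v = y := by
  by_contra hne
  have huI := h.2.1.1 hu
  have hvI := h.2.2.1.1 hv
  have hI : u ⊔ v ∈ IccR (α := α) (· ≤ ·) x y :=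
    ⟨le_trans huI.1 le_sup_left, sup_le huI.2 hvI.2⟩
  have hx : u ⊔ v ≠ x := fun e => hux (le_antisymm (e ▸ le_sup_left) huI.1)
  rw [h.2.2.2.2.1] at hI
  rcases hI with hI | hI
  · exact hp_inc h hI hv hx hne hvx hvy (Or.inr le_sup_right)
  · exact hp_inc h hu hI hux huy hx hne (Or.inl le_sup_left)

/-- Edges of the image chain lift to edges of the chain. -/
theorem hp_lift {L M : Type*} [Lattice L] [Lattice M] [Finite L] (q : L → M)
    (hmono : Monotone q) {x y : L} {D : Set L}
    (hD : MaxChainIn (α := L) (· ≤ ·) (IccR (· ≤ ·) x y) D) {A B : M}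
    (hA : A ∈ q '' D) (hB : B ∈ q '' D) (hAB : A ⋖ B) :
    ∃ a ∈ D, ∃ b ∈ D, a ⋖ b ∧ q a = A ∧ q b = B := by
  obtain ⟨a0, ha0, rfl⟩ := hA
  obtain ⟨b0, hb0, rfl⟩ := hB
  obtain ⟨a, -, ha⟩ := (Set.toFinite {z : L | z ∈ D ∧ q z = q a0}).exists_le_maximal
    (a := a0) ⟨ha0, rfl⟩
  have haD := ha.prop.1
  have hqa := ha.prop.2
  have hab0 : a < b0 := by
    rcases hD.2.1.total haD hb0 with h | h
    · exact lt_of_le_of_ne h fun e => hAB.ne (by rw [← hqa, e])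
    · exact absurd (hmono h) (by rw [hqa]; exact hAB.lt.not_ge)
  obtain ⟨b, hbb0, hb⟩ := (Set.toFinite {z : L | z ∈ D ∧ a < z}).exists_le_minimal
    (a := b0) ⟨hb0, hab0⟩
  have hbD := hb.prop.1
  have hab := hb.prop.2
  refine ⟨a, haD, b, hbD, ⟨hab, fun c hac hcb => ?_⟩, hqa, ?_⟩
  · have hcD : c ∈ D := by
      have hins : D = insert c D := by
        apply hD.2.2
        · rintro z (rfl | hz)
          · exact ⟨(hD.1 haD).1.trans hac.le, hcb.le.trans (hD.1 hbD).2⟩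
          · exact hD.1 hz
        · refine hD.2.1.insert fun z hz _ => ?_
          rcases hD.2.1.total hz haD with h | h
          · exact Or.inr (h.trans hac.le)
          · rcases eq_or_lt_of_le h with h | h
            · exact Or.inr (h ▸ hac.le)
            · left
              rcases hD.2.1.total hz hbD with h' | h'
              · exact hcb.le.trans (hb.le_of_le ⟨hz, h⟩ h')
              · exact hcb.le.trans h'
        · exact Set.subset_insert _ _
      rw [hins]; exact Set.mem_insert _ _
    exact hcb.not_ge (hb.le_of_le ⟨hcD, hac⟩ hcb.le)
  · rcases hAB.eq_or_eq (hqa ▸ hmono hab.le) (hmono hbb0) with h | h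
    · exact absurd (ha.le_of_ge ⟨hbD, h⟩ hab.le) hab.not_ge
    · exact h

theorem hp_transfer {L M E : Type*} [Lattice L] [Lattice M] [Finite L]
    (lab : L → L → E) (q : L → M)
    (hmono : Monotone q) (lab' : M → M → E)
    (hcompat : ∀ x y : L, x ⋖ y → q x ⋖ q y → lab' (q x) (q y) = lab x y)
    {x y : L} {D : Set L} {C : Set M}
    (hD : MaxChainIn (α := L) (· ≤ ·) (IccR (· ≤ ·) x y) D) (hC : C ⊆ q '' D)
    (lt : E → E → Prop) (h : ChainAscending (· ≤ ·) lab lt D) :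
    ChainAscending (· ≤ ·) lab' lt C := by
  intro A B A' B' hA hB hA' hB' hAB hAB' hle
  rw [hp_cov] at hAB hAB'
  obtain ⟨a, ha, b, hb, hab, rfl, rfl⟩ := hp_lift q hmono hD (hC hA) (hC hB) hAB
  obtain ⟨c, hc, d, hd, hcd, rfl, rfl⟩ := hp_lift q hmono hD (hC hA') (hC hB') hAB'
  rw [hcompat _ _ hab hAB, hcompat _ _ hcd hAB']
  refine h a b c d ha hb hc hd (hp_cov.2 hab) (hp_cov.2 hcd) ?_
  rcases hD.2.1.total hb hc with h | h
  · exact h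
  rcases hD.2.1.total ha hc with h' | h'
  · rcases hab.eq_or_eq h' h with e | e
    · subst e
      exact absurd hle hAB.lt.not_ge
    · exact e.ge
  · exact absurd (hle.trans (hmono h')) hAB.lt.not_ge

theorem hp_cover {C M' : Type*} [Lattice C] [Lattice M'] [Finite C] (q : C → M')
    (hsurj : Function.Surjective q) (hmono : Monotone q)
    (hsup : ∀ x y : C, q (x ⊔ y) = q x ⊔ q y)
    {x : C} (hx : ∀ z, x ≤ z → q z = q x → z = x) {A : M'} (hA : q x ⋖ A) :
    ∃ z, x ⋖ z ∧ q z = A := by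
  obtain ⟨a, rfl⟩ := hsurj A
  have hqa : q (x ⊔ a) = q a := by rw [hsup]; exact sup_eq_right.2 hA.le
  have hlt : x < x ⊔ a := lt_of_le_of_ne le_sup_left fun e => hA.ne (by rw [← hqa, ← e])
  obtain ⟨z, hxz, hz⟩ := exists_covBy_le_of_lt hlt
  refine ⟨z, hxz, ?_⟩
  rcases hA.eq_or_eq (hmono hxz.le) (hqa ▸ hmono hz) with h | h
  · exact absurd (hx z hxz.le h) hxz.ne'
  · exact h

theorem hp_sub {L M : Type*} [Lattice L] [Lattice M] [Finite M]
    (q : L → M) (hmono : Monotone q) {x y : L} {D₁ D₂ : Set L} {C₁ C₂ : Set M}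
    (hC : IsPolygonPair (α := M) (· ≤ ·) (q x) (q y) C₁ C₂)
    (hD : IsPolygonPair (α := L) (· ≤ ·) x y D₁ D₂)
    (him : ∀ w, q x ≤ w → w ≤ q y → ∃ v, x ≤ v ∧ v ≤ y ∧ q v = w)
    {z : L} (hz : z ∈ D₂) (hqz : q z ∈ C₂) (hzx : q z ≠ q x) (hzy : q z ≠ q y) :
    C₁ ⊆ q '' D₁ := by
  intro w hw
  have hwI := hC.2.1.1 hw
  by_cases hwx : w = q x
  · exact ⟨x, (hp_ends hD).1, hwx.symm⟩
  by_cases hwy : w = q y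
  · exact ⟨y, (hp_ends hD).2, hwy.symm⟩
  obtain ⟨v, h1, h2, rfl⟩ := him w hwI.1 hwI.2
  have hv : v ∈ IccR (α := L) (· ≤ ·) x y := ⟨h1, h2⟩
  rw [hD.2.2.2.2.1] at hv
  rcases hv with hv | hv
  · exact ⟨v, hv, rfl⟩
  · refine absurd ?_ (hp_inc hC hw hqz hwx hwy hzx hzy)
    rcases hD.2.2.1.2.1.total hv hz with h | h
    · exact Or.inl (hmono h)
    · exact Or.inr (hmono h)

end Helpers

/-- Let `L` be a finite polygonal lattice with `lab` a forcing-consistent edge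
labelling valued in a finite poset `E`, and let `q : L → M` realise a lattice
congruence on `L` as a lattice quotient.  If `lab` is polygonal, then the
quotient edge labelling `lab'` (characterised by `lab' (q x) (q y) = lab x y`
whenever `x ⋖ y` in `L` and `q x ⋖ q y` in `M`) is polygonal as well. -/
theorem quotient_labelling_polygonal {L M E : Type*} [Lattice L] [Lattice M]
    [Finite L] [Finite M] [PartialOrder E] [Finite E]
    (hL : IsPolygonalLattice L) (lab : L → L → E)
    (hfc : ForcingConsistent lab) (hpl : PolygonalLabelling lab)
    (q : L → M) (hsurj : Function.Surjective q)
    (hsup : ∀ x y : L, q (x ⊔ y) = q x ⊔ q y)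
    (hinf : ∀ x y : L, q (x ⊓ y) = q x ⊓ q y)
    (lab' : M → M → E)
    (hcompat : ∀ x y : L, x ⋖ y → q x ⋖ q y → lab' (q x) (q y) = lab x y) :
    PolygonalLabelling lab' := by
  have hmono : Monotone q := fun a b hab => by
    have := hsup a b
    rw [sup_eq_right.2 hab] at this
    rw [this]; exact le_sup_left
  intro X Y C₁ C₂ hC hcard
  obtain ⟨x0, hx0⟩ := hsurj X
  obtain ⟨x, -, hxm⟩ := (Set.toFinite {z : L | q z = X}).exists_le_maximal (a := x0) hx0
  have hqx : q x = X := hxm.prop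
  subst hqx
  have hx : ∀ z, x ≤ z → q z = q x → z = x := fun z h1 h2 =>
    le_antisymm (hxm.le_of_ge h2 h1) h1
  obtain ⟨A₁, hA₁, hc₁, hy₁⟩ := hp_atom hC
  obtain ⟨A₂, hA₂, hc₂, hy₂⟩ := hp_atom (hp_symm hC)
  have hinc := hp_inc hC hA₁ hA₂ hc₁.ne' hy₁ hc₂.ne' hy₂
  have hjoin := hp_join hC hA₁ hA₂ hc₁.ne' hy₁ hc₂.ne' hy₂
  obtain ⟨z₁, hz₁, rfl⟩ := hp_cover q hsurj hmono hsup hx hc₁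
  obtain ⟨z₂, hz₂, rfl⟩ := hp_cover q hsurj hmono hsup hx hc₂
  have hne : z₁ ≠ z₂ := fun e => hinc (Or.inl (by rw [e]))
  rw [← hsup] at hjoin
  subst hjoin
  obtain ⟨x', y', D₁, D₂, hI, hD⟩ := hL.1 x z₁ z₂ hne hz₁ hz₂
  set y := z₁ ⊔ z₂ with hy
  have hxy : x ≤ y := hz₁.le.trans le_sup_left
  have hmem : ∀ z, (x ≤ z ∧ z ≤ y) ↔ (x' ≤ z ∧ z ≤ y') := fun z => Set.ext_iff.1 hI z
  have ex : x' = x := le_antisymm ((hmem x).1 ⟨le_rfl, hxy⟩).1 ((hmem x').2 ⟨le_rfl, hD.1⟩).1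
  have ey : y' = y := le_antisymm ((hmem y').2 ⟨hD.1, le_rfl⟩).2 ((hmem y).1 ⟨hxy, le_rfl⟩).2
  subst ex
  rw [ey] at hD
  clear hI hmem ey
  have him : ∀ w, q x' ≤ w → w ≤ q y → ∃ v, x' ≤ v ∧ v ≤ y ∧ q v = w := by
    intro w h1 h2
    obtain ⟨v, rfl⟩ := hsurj w
    refine ⟨(v ⊔ x') ⊓ y, le_inf le_sup_right hxy, inf_le_right, ?_⟩
    rw [hinf, hsup, sup_eq_left.2 h1, inf_eq_left.2 h2]
  have hcard' : (IccR (α := L) (· ≤ ·) x' y).ncard ≠ 4 := by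
    have himg : IccR (α := M) (· ≤ ·) (q x') (q y) ⊆ q '' IccR (α := L) (· ≤ ·) x' y := by
      rintro w ⟨h1, h2⟩
      obtain ⟨v, h3, h4, h5⟩ := him w h1 h2
      exact ⟨v, ⟨h3, h4⟩, h5⟩
    have h1 := (Set.ncard_le_ncard himg (Set.toFinite _)).trans
      (Set.ncard_image_le (Set.toFinite _))
    have h12 : q z₁ ≠ q z₂ := fun e => hinc (Or.inl e.le)
    have hxyq : q x' ≠ q y := fun e => hc₁.ne (le_antisymm hc₁.le (e ▸ hmono le_sup_left))
    have h4 : ({q x', q z₁, q z₂, q y} : Set M).ncard = 4 := by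
      rw [Set.ncard_insert_of_notMem, Set.ncard_insert_of_notMem, Set.ncard_pair hy₂]
      · simp only [Set.mem_insert_iff, Set.mem_singleton_iff, not_or]
        exact ⟨h12, hy₁⟩
      · simp only [Set.mem_insert_iff, Set.mem_singleton_iff, not_or]
        exact ⟨hc₁.ne, hc₂.ne, hxyq⟩
    have hsub : ({q x', q z₁, q z₂, q y} : Set M) ⊆ IccR (α := M) (· ≤ ·) (q x') (q y) := by
      have a1 := hC.2.1.1 hA₁
      have a2 := hC.2.2.1.1 hA₂
      rintro w (rfl | rfl | rfl | rfl)
      · exact ⟨le_rfl, hC.1⟩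
      · exact a1
      · exact a2
      · exact ⟨hC.1, le_rfl⟩
    have h5 := Set.ncard_le_ncard hsub (Set.toFinite _)
    omega
  have key : ∀ D₁ D₂ : Set L, IsPolygonPair (α := L) (· ≤ ·) x' y D₁ D₂ → z₁ ∈ D₁ → z₂ ∈ D₂ →
      (ChainAscending (· ≤ ·) lab' (· < ·) C₁ ∧
        ChainAscending (· ≤ ·) lab' (fun a b => b < a) C₂) ∨
      (ChainAscending (· ≤ ·) lab' (· < ·) C₂ ∧
        ChainAscending (· ≤ ·) lab' (fun a b => b < a) C₁) := by
    intro D₁ D₂ hD m₁ m₂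
    have s₁ := hp_sub q hmono hC hD him m₂ hA₂ hc₂.ne' hy₂
    have s₂ := hp_sub q hmono (hp_symm hC) (hp_symm hD) him m₁ hA₁ hc₁.ne' hy₁
    have t₁ := hp_transfer lab q hmono lab' hcompat hD.2.1 s₁
    have t₂ := hp_transfer lab q hmono lab' hcompat hD.2.2.1 s₂
    rcases hpl x' y D₁ D₂ hD hcard' with ⟨h1, h2⟩ | ⟨h1, h2⟩
    · exact Or.inl ⟨t₁ _ h1, t₂ _ h2⟩
    · exact Or.inr ⟨t₂ _ h1, t₁ _ h2⟩
  have i₁ : z₁ ∈ IccR (α := L) (· ≤ ·) x' y := ⟨hz₁.le, le_sup_left⟩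
  have i₂ : z₂ ∈ IccR (α := L) (· ≤ ·) x' y := ⟨hz₂.le, le_sup_right⟩
  have hinc' : ¬ (z₁ ≤ z₂ ∨ z₂ ≤ z₁) := fun h => hinc (h.imp (fun h => hmono h) fun h => hmono h)
  rw [hD.2.2.2.2.1] at i₁ i₂
  rcases i₁ with i₁ | i₁ <;> rcases i₂ with i₂ | i₂
  · exact absurd (hD.2.1.2.1.total i₁ i₂) hinc'
  · exact key D₁ D₂ hD i₁ i₂
  · exact key D₂ D₁ (hp_symm hD) i₁ i₂
  · exact absurd (hD.2.2.1.2.1.total i₁ i₂) hinc'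
end

section
/- Let L be a finite polygonal lattice with λ : CovRel(L) → E a forcing-consistent polygonal edge labelling, θ a lattice congruence on L, and q : L → L/θ the quotient map. Then the induced map on square-equivalence classes of maximal chains, sending [C] to [q(C)], is an order-preserving surjection from (square-equivalence classes of maximal chains of L, ≼_λ) to (square-equivalence classes of maximal chains of L/θ, ≼_{λ_θ}). -/
section Helpers

theorem exists_maxChainIn {L : Type*} [Lattice L] [Finite L] (S K : Set L)
    (hK : K ⊆ S) (hc : IsChain (· ≤ ·) K) :
    ∃ C, K ⊆ C ∧ MaxChainIn (· ≤ ·) S C := by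
  obtain ⟨C, hKC, hC⟩ := Set.Finite.exists_le_maximal
    (s := {C : Set L | C ⊆ S ∧ IsChain (· ≤ ·) C}) (Set.toFinite _) (a := K) ⟨hK, hc⟩
  refine ⟨C, hKC, hC.prop.1, hC.prop.2, fun C' h1 h2 h3 => ?_⟩
  exact hC.eq_of_le ⟨h1, h2⟩ h3

theorem IsPolygonPair.swap {L : Type*} {r : L → L → Prop} {x y : L} {P₁ P₂ : Set L}
    (h : IsPolygonPair r x y P₁ P₂) : IsPolygonPair r x y P₂ P₁ := by
  obtain ⟨h1, h2, h3, h4, h5, h6, h7⟩ := h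
  refine ⟨h1, h3, h2, h4.symm, by rw [h5, Set.union_comm], by rw [Set.inter_comm, h6], ?_⟩
  intro C hC
  exact (h7 C hC).symm

variable {L : Type*} [Lattice L] [Finite L] {x y : L} {P₁ P₂ : Set L}

theorem pp_mem_s12 (h : IsPolygonPair (· ≤ ·) x y P₁ P₂) : x ∈ P₁ ∧ y ∈ P₁ := by
  obtain ⟨h1, h2, h3, h4, h5, h6, h7⟩ := h
  constructor
  · exact (h6.symm.subset (by simp : x ∈ ({x, y} : Set L))).1
  · exact (h6.symm.subset (by simp : y ∈ ({x, y} : Set L))).1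

theorem pp_int (h : IsPolygonPair (· ≤ ·) x y P₁ P₂) : ∃ a ∈ P₁, a ≠ x ∧ a ≠ y := by
  by_contra hcon
  push Not at hcon
  obtain ⟨h1, h2, h3, h4, h5, h6, h7⟩ := h
  apply h4
  apply h2.2.2 P₂ h3.1 h3.2.1
  intro a ha
  have : a ∈ ({x, y} : Set L) := by
    by_cases hx : a = x
    · simp [hx]
    · simp [hcon a ha hx]
  exact (h6.symm.subset this).2

theorem pp_bd (h : IsPolygonPair (· ≤ ·) x y P₁ P₂) {a : L} (ha : a ∈ P₁) :
    x ≤ a ∧ a ≤ y := h.2.1.1 ha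

theorem pp_not_le (h : IsPolygonPair (· ≤ ·) x y P₁ P₂) {a b : L} (ha : a ∈ P₁)
    (hax : a ≠ x) (hay : a ≠ y) (hb : b ∈ P₂) (hbx : b ≠ x) (hby : b ≠ y) : ¬ a ≤ b := by
  intro hab
  have hba := pp_bd h ha
  have hbb := pp_bd h.swap hb
  obtain ⟨h1, h2, h3, h4, h5, h6, h7⟩ := h
  obtain ⟨C, hC, hm⟩ := exists_maxChainIn (IccR (· ≤ ·) x y) {a, b} (by
    rintro z (rfl | rfl)
    · exact hba
    · exact hbb) (IsChain.pair hab)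
  have haC : a ∈ C := hC (by simp)
  have hbC : b ∈ C := hC (by simp)
  rcases h7 C hm with rfl | rfl
  · have := h6.subset ⟨hbC, hb⟩
    simp [hbx, hby] at this
  · have := h6.subset ⟨ha, haC⟩
    simp [hax, hay] at this

theorem pp_inf (h : IsPolygonPair (· ≤ ·) x y P₁ P₂) {a b : L} (ha : a ∈ P₁)
    (hax : a ≠ x) (hay : a ≠ y) (hb : b ∈ P₂) (hbx : b ≠ x) (hby : b ≠ y) : a ⊓ b = x := by
  by_contra hne
  have hba := pp_bd h ha
  have hbb := pp_bd h.swap hb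
  have hm : a ⊓ b ∈ P₁ ∪ P₂ := h.2.2.2.2.1.subset
    ⟨le_inf hba.1 hbb.1, inf_le_left.trans hba.2⟩
  have hny : a ⊓ b ≠ y := fun e => hay (le_antisymm hba.2 (e ▸ inf_le_left))
  rcases hm with hm | hm
  · exact pp_not_le h hm hne hny hb hbx hby inf_le_right
  · exact pp_not_le h.swap hm hne hny ha hax hay inf_le_left

theorem pp_sup (h : IsPolygonPair (· ≤ ·) x y P₁ P₂) {a b : L} (ha : a ∈ P₁)
    (hax : a ≠ x) (hay : a ≠ y) (hb : b ∈ P₂) (hbx : b ≠ x) (hby : b ≠ y) : a ⊔ b = y := by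
  by_contra hne
  have hba := pp_bd h ha
  have hbb := pp_bd h.swap hb
  have hm : a ⊔ b ∈ P₁ ∪ P₂ := h.2.2.2.2.1.subset
    ⟨hba.1.trans le_sup_left, sup_le hba.2 hbb.2⟩
  have hny : a ⊔ b ≠ x := fun e => hax (le_antisymm (e ▸ le_sup_left) hba.1)
  rcases hm with hm | hm
  · exact pp_not_le h.swap hb hbx hby hm hny hne le_sup_right
  · exact pp_not_le h ha hax hay hm hny hne le_sup_left

/-- An element of a chain through `P₁` outside `P₁` is below `x` or above `y`. -/
theorem pp_outside (h : IsPolygonPair (· ≤ ·) x y P₁ P₂) {C : Set L}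
    (hC : IsChain (· ≤ ·) C) (hP : P₁ ⊆ C) {c : L} (hc : c ∈ C) (hcP : c ∉ P₁) :
    c ≤ x ∨ y ≤ c := by
  by_contra hcon
  push Not at hcon
  have hm := pp_mem_s12 h
  have h1 : x ≤ c := (hC.total (hP hm.1) hc).resolve_right hcon.1
  have h2 : c ≤ y := (hC.total hc (hP hm.2)).resolve_right hcon.2
  have := h.2.1.2.2 (C ∩ IccR (· ≤ ·) x y) Set.inter_subset_right
    (hC.mono Set.inter_subset_left) (Set.subset_inter hP h.2.1.1)
  exact hcP (this.symm.subset ⟨hc, h1, h2⟩)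

theorem move_chain (h : IsPolygonPair (· ≤ ·) x y P₁ P₂) {C C' : Set L}
    (hC : IsChain (· ≤ ·) C) (hP : P₁ ⊆ C)
    (hd : C \ P₁ = C' \ P₂) : IsChain (· ≤ ·) C' := by
  have key : ∀ a ∈ C', ∀ b ∈ C', a ∉ P₂ → a ≤ b ∨ b ≤ a := by
    intro a ha b hb hna
    have haC : a ∈ C \ P₁ := hd.symm.subset ⟨ha, hna⟩
    by_cases hnb : b ∈ P₂
    · have hbb := pp_bd h.swap hnb
      rcases pp_outside h hC hP haC.1 haC.2 with h1 | h1
      · exact Or.inl (h1.trans hbb.1)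
      · exact Or.inr (hbb.2.trans h1)
    · have hbC : b ∈ C \ P₁ := hd.symm.subset ⟨hb, hnb⟩
      exact hC.total haC.1 hbC.1
  intro a ha b hb hab
  by_cases hna : a ∈ P₂
  · by_cases hnb : b ∈ P₂
    · exact h.2.2.1.2.1 hna hnb hab
    · exact (key b hb a ha hnb).symm
  · exact key a ha b hb hna

variable {M : Type*} [Lattice M] {q : L → M}

theorem q_mono_s12 (hinf : ∀ x y : L, q (x ⊓ y) = q x ⊓ q y) : Monotone q := by
  intro a b hab
  have := hinf a b
  rw [inf_eq_left.2 hab] at this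
  rw [this]; exact inf_le_right

theorem q_Icc (hsurj : Function.Surjective q)
    (hsup : ∀ x y : L, q (x ⊔ y) = q x ⊔ q y)
    (hinf : ∀ x y : L, q (x ⊓ y) = q x ⊓ q y) (hxy : x ≤ y) :
    IccR (· ≤ ·) (q x) (q y) = q '' (IccR (· ≤ ·) x y) := by
  apply Set.Subset.antisymm
  · rintro m ⟨h1, h2⟩
    obtain ⟨w, rfl⟩ := hsurj m
    refine ⟨(w ⊔ x) ⊓ y, ⟨le_inf le_sup_right hxy, inf_le_right⟩, ?_⟩
    rw [hinf, hsup, sup_eq_left.2 h1, inf_eq_left.2 h2]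
  · rintro _ ⟨w, ⟨h1, h2⟩, rfl⟩
    exact ⟨q_mono_s12 hinf h1, q_mono_s12 hinf h2⟩

/-- Collapse: an interior element identified with an endpoint collapses the polygon. -/
theorem collapse_aux (hsup : ∀ x y : L, q (x ⊔ y) = q x ⊔ q y)
    (hinf : ∀ x y : L, q (x ⊓ y) = q x ⊓ q y)
    (h : IsPolygonPair (· ≤ ·) x y P₁ P₂) {a : L} (ha : a ∈ P₁)
    (hax : a ≠ x) (hay : a ≠ y) (hq : q a = q x ∨ q a = q y) :
    q '' P₁ = {q x, q y} ∧ q '' P₂ = {q x, q y} := by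
  have hmono := q_mono_s12 hinf
  have m1 := pp_mem_s12 h
  have m2 := pp_mem_s12 h.swap
  obtain ⟨b₀, hb₀, hb₀x, hb₀y⟩ := pp_int h.swap
  have A : (∀ b ∈ P₂, q b = q x ∨ q b = q y) ∧ (∀ a ∈ P₁, q a = q x ∨ q a = q y) := by
    rcases hq with hq | hq
    · have B : ∀ b ∈ P₂, b ≠ x → b ≠ y → q b = q y := by
        intro b hb hbx hby
        have e := hsup a b
        rw [pp_sup h ha hax hay hb hbx hby, hq,
          sup_eq_right.2 (hmono (pp_bd h.swap hb).1)] at e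
        exact e.symm
      constructor
      · intro b hb
        by_cases hbx : b = x
        · left; rw [hbx]
        by_cases hby : b = y
        · right; rw [hby]
        exact Or.inr (B b hb hbx hby)
      · intro a' ha'
        by_cases hbx : a' = x
        · left; rw [hbx]
        by_cases hby : a' = y
        · right; rw [hby]
        left
        have e := hinf a' b₀
        rw [pp_inf h ha' hbx hby hb₀ hb₀x hb₀y, B b₀ hb₀ hb₀x hb₀y,
          inf_eq_left.2 (hmono (pp_bd h ha').2)] at e
        exact e.symm
    · have B : ∀ b ∈ P₂, b ≠ x → b ≠ y → q b = q x := by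
        intro b hb hbx hby
        have e := hinf a b
        rw [pp_inf h ha hax hay hb hbx hby, hq,
          inf_eq_right.2 (hmono (pp_bd h.swap hb).2)] at e
        exact e.symm
      constructor
      · intro b hb
        by_cases hbx : b = x
        · left; rw [hbx]
        by_cases hby : b = y
        · right; rw [hby]
        exact Or.inl (B b hb hbx hby)
      · intro a' ha'
        by_cases hbx : a' = x
        · left; rw [hbx]
        by_cases hby : a' = y
        · right; rw [hby]
        right
        have e := hsup a' b₀
        rw [pp_sup h ha' hbx hby hb₀ hb₀x hb₀y, B b₀ hb₀ hb₀x hb₀y,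
          sup_eq_left.2 (hmono (pp_bd h ha').1)] at e
        exact e.symm
  constructor
  · apply Set.Subset.antisymm
    · rintro _ ⟨c, hc, rfl⟩
      simpa using A.2 c hc
    · rintro _ (rfl | rfl)
      · exact ⟨x, m1.1, rfl⟩
      · exact ⟨y, m1.2, rfl⟩
  · apply Set.Subset.antisymm
    · rintro _ ⟨c, hc, rfl⟩
      simpa using A.1 c hc
    · rintro _ (rfl | rfl)
      · exact ⟨x, m2.1, rfl⟩
      · exact ⟨y, m2.2, rfl⟩

/-- An image of `P₂` comparable to the image of an interior point of `P₁`. -/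
theorem comp_aux (hsup : ∀ x y : L, q (x ⊔ y) = q x ⊔ q y)
    (hinf : ∀ x y : L, q (x ⊓ y) = q x ⊓ q y)
    (h : IsPolygonPair (· ≤ ·) x y P₁ P₂) {a b : L} (ha : a ∈ P₁)
    (hax : a ≠ x) (hay : a ≠ y) (hb : b ∈ P₂) (hc : q a ≤ q b ∨ q b ≤ q a) :
    q b = q x ∨ q b = q y := by
  by_cases hbx : b = x
  · left; rw [hbx]
  by_cases hby : b = y
  · right; rw [hby]
  rcases hc with hc | hc
  · right
    have e := hsup a b
    rw [pp_sup h ha hax hay hb hbx hby, sup_eq_right.2 hc] at e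
    exact e.symm
  · left
    have e := hinf a b
    rw [pp_inf h ha hax hay hb hbx hby, inf_eq_right.2 hc] at e
    exact e.symm

theorem maxchain_image (hsurj : Function.Surjective q)
    (hsup : ∀ x y : L, q (x ⊔ y) = q x ⊔ q y)
    (hinf : ∀ x y : L, q (x ⊓ y) = q x ⊓ q y)
    (h : IsPolygonPair (· ≤ ·) x y P₁ P₂) :
    MaxChainIn (· ≤ ·) (IccR (· ≤ ·) (q x) (q y)) (q '' P₁) := by
  have hmono := q_mono_s12 hinf
  have m1 := pp_mem_s12 h
  refine ⟨?_, ?_, ?_⟩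
  · rw [q_Icc hsurj hsup hinf h.1]
    exact Set.image_mono h.2.1.1
  · rintro _ ⟨a, ha, rfl⟩ _ ⟨b, hb, rfl⟩ _
    rcases h.2.1.2.1.total ha hb with h1 | h1
    · exact Or.inl (hmono h1)
    · exact Or.inr (hmono h1)
  · intro K hK hKc hsub
    apply Set.Subset.antisymm hsub
    intro m hm
    have hm' := hK hm
    rw [q_Icc hsurj hsup hinf h.1, h.2.2.2.2.1] at hm'
    obtain ⟨w, hw | hw, rfl⟩ := hm'
    · exact ⟨w, hw, rfl⟩
    · obtain ⟨a, ha, hax, hay⟩ := pp_int h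
      rcases comp_aux hsup hinf h ha hax hay hw (hKc.total (hsub ⟨a, ha, rfl⟩) hm) with e | e
      · rw [e]; exact ⟨x, m1.1, rfl⟩
      · rw [e]; exact ⟨y, m1.2, rfl⟩

theorem polygon_image (hsurj : Function.Surjective q)
    (hsup : ∀ x y : L, q (x ⊔ y) = q x ⊔ q y)
    (hinf : ∀ x y : L, q (x ⊓ y) = q x ⊓ q y)
    (h : IsPolygonPair (· ≤ ·) x y P₁ P₂) :
    (q '' P₁ = {q x, q y} ∧ q '' P₂ = {q x, q y}) ∨
    (IsPolygonPair (· ≤ ·) (q x) (q y) (q '' P₁) (q '' P₂) ∧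
      4 ≤ (IccR (· ≤ ·) (q x) (q y)).ncard) := by
  have hmono := q_mono_s12 hinf
  have m1 := pp_mem_s12 h
  have m2 := pp_mem_s12 h.swap
  obtain ⟨a, ha, hax, hay⟩ := pp_int h
  obtain ⟨b, hb, hbx, hby⟩ := pp_int h.swap
  by_cases hA : q a = q x ∨ q a = q y
  · exact Or.inl (collapse_aux hsup hinf h ha hax hay hA)
  by_cases hB : q b = q x ∨ q b = q y
  · exact Or.inl (collapse_aux hsup hinf h.swap hb hbx hby hB).symm
  right
  have hI : IccR (· ≤ ·) (q x) (q y) = q '' P₁ ∪ q '' P₂ := by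
    rw [q_Icc hsurj hsup hinf h.1, h.2.2.2.2.1, Set.image_union]
  have hn : q a ∉ q '' P₂ := by
    rintro ⟨c, hc, e⟩
    have := comp_aux hsup hinf h ha hax hay hc (Or.inl e.symm.le)
    rw [e] at this
    exact hA this
  refine ⟨⟨hmono h.1, maxchain_image hsurj hsup hinf h, maxchain_image hsurj hsup hinf h.swap,
    fun e => hn (e ▸ ⟨a, ha, rfl⟩), hI, ?_, ?_⟩, ?_⟩
  · apply Set.Subset.antisymm
    · rintro _ ⟨⟨c, hc, rfl⟩, ⟨d, hd, e⟩⟩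
      by_cases hcx : c = x
      · simp [hcx]
      by_cases hcy : c = y
      · simp [hcy]
      have := comp_aux hsup hinf h hc hcx hcy hd (Or.inl e.symm.le)
      rw [e] at this
      simpa using this
    · rintro _ (rfl | rfl)
      · exact ⟨⟨x, m1.1, rfl⟩, ⟨x, m2.1, rfl⟩⟩
      · exact ⟨⟨y, m1.2, rfl⟩, ⟨y, m2.2, rfl⟩⟩
  · intro K hK
    have M1 := maxchain_image hsurj hsup hinf h
    have M2 := maxchain_image hsurj hsup hinf h.swap
    by_cases h1 : K ⊆ q '' P₁
    · exact Or.inl (hK.2.2 _ M1.1 M1.2.1 h1)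
    by_cases h2 : K ⊆ q '' P₂
    · exact Or.inr (hK.2.2 _ M2.1 M2.2.1 h2)
    exfalso
    rw [Set.not_subset] at h1 h2
    obtain ⟨m, hm, hm1⟩ := h1
    obtain ⟨n, hnK, hn2⟩ := h2
    have hm' := (hI.subset (hK.1 hm)).resolve_left hm1
    have hn' := (hI.subset (hK.1 hnK)).resolve_right hn2
    obtain ⟨d, hd, rfl⟩ := hm'
    obtain ⟨c, hc, rfl⟩ := hn'
    have hcx : c ≠ x := fun e => hn2 ⟨x, m2.1, by rw [e]⟩
    have hcy : c ≠ y := fun e => hn2 ⟨y, m2.2, by rw [e]⟩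
    rcases comp_aux hsup hinf h hc hcx hcy hd (hK.2.1.total hnK hm) with e | e
    · exact hm1 ⟨x, m1.1, e.symm⟩
    · exact hm1 ⟨y, m1.2, e.symm⟩
  · have hxy : q x ≠ q y := by
      intro e
      apply hA; left
      exact le_antisymm (e ▸ hmono (pp_bd h ha).2) (hmono (pp_bd h ha).1)
    push Not at hA hB
    have hab : q a ≠ q b := fun e => hn (e ▸ ⟨b, hb, rfl⟩)
    have hs : ({q x, q y, q a, q b} : Set M) ⊆ IccR (· ≤ ·) (q x) (q y) := by
      rw [hI]
      rintro _ (rfl | rfl | rfl | rfl)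
      · exact Or.inl ⟨x, m1.1, rfl⟩
      · exact Or.inl ⟨y, m1.2, rfl⟩
      · exact Or.inl ⟨a, ha, rfl⟩
      · exact Or.inr ⟨b, hb, rfl⟩
    have hf : (IccR (· ≤ ·) (q x) (q y)).Finite := by
      rw [q_Icc hsurj hsup hinf h.1]; exact Set.toFinite _
    have := Set.ncard_le_ncard hs hf
    rw [Set.ncard_insert_of_notMem (by simp [hxy, hA.1.symm, hB.1.symm]),
      Set.ncard_insert_of_notMem (by simp [hA.2.symm, hB.2.symm]),
      Set.ncard_pair hab] at this
    omega

theorem diff_image_aux (hinf : ∀ x y : L, q (x ⊓ y) = q x ⊓ q y)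
    (h : IsPolygonPair (· ≤ ·) x y P₁ P₂) {C C' : Set L}
    (hC : IsChain (· ≤ ·) C) (hP : P₁ ⊆ C) (hd : C \ P₁ = C' \ P₂) :
    q '' C \ q '' P₁ ⊆ q '' C' \ q '' P₂ := by
  have hmono := q_mono_s12 hinf
  have m1 := pp_mem_s12 h
  rintro _ ⟨⟨c, hc, rfl⟩, hn⟩
  have hc1 : c ∉ P₁ := fun e => hn ⟨c, e, rfl⟩
  refine ⟨⟨c, (hd.subset ⟨hc, hc1⟩).1, rfl⟩, ?_⟩
  rintro ⟨d, hd, e⟩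
  have hbd := pp_bd h.swap hd
  rcases pp_outside h hC hP hc hc1 with h1 | h1
  · exact hn ⟨x, m1.1, le_antisymm (e ▸ hmono hbd.1) (hmono h1)⟩
  · exact hn ⟨y, m1.2, le_antisymm (hmono h1) (e ▸ hmono hbd.2)⟩

theorem pp_image_eq_of_collapse {C C' : Set L} (hP : P₁ ⊆ C) (hP' : P₂ ⊆ C')
    (hd : C \ P₁ = C' \ P₂) (hq : q '' P₁ = q '' P₂) : q '' C = q '' C' := by
  rw [← Set.diff_union_of_subset hP, ← Set.diff_union_of_subset hP', Set.image_union,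
    Set.image_union, hq, hd]

/-- The next element after `a` in a maximal chain of an interval. -/
theorem lift_cover (hinf : ∀ x y : L, q (x ⊓ y) = q x ⊓ q y)
    (h : IsPolygonPair (· ≤ ·) x y P₁ P₂) {A B : M} (hA : A ∈ q '' P₁) (hB : B ∈ q '' P₁)
    (hAB : CovR (· ≤ ·) A B) :
    ∃ a ∈ P₁, ∃ b ∈ P₁, q a = A ∧ q b = B ∧ CovR (· ≤ ·) a b ∧ ∀ c ∈ P₁, q c = A → c ≤ a := by
  have hmono := q_mono_s12 hinf
  have hch := h.2.1.2.1
  obtain ⟨a₀, ha₀, rfl⟩ := hA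
  obtain ⟨b₀, hb₀, rfl⟩ := hB
  obtain ⟨a, -, ha⟩ := Set.Finite.exists_le_maximal
    (s := {c | c ∈ P₁ ∧ q c = q a₀}) (Set.toFinite _) (a := a₀) ⟨ha₀, rfl⟩
  obtain ⟨hAle, hAne, hAc⟩ := hAB
  have hnb : ¬ b₀ ≤ a := fun hh => hAne (le_antisymm hAle (ha.prop.2 ▸ hmono hh))
  have hab₀ : a ≤ b₀ := (hch.total ha.prop.1 hb₀).resolve_right hnb
  obtain ⟨b, hbb₀, hb⟩ := Set.Finite.exists_le_minimal
    (s := {c | c ∈ P₁ ∧ a < c}) (Set.toFinite _) (a := b₀)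
    ⟨hb₀, lt_of_le_not_ge hab₀ hnb⟩
  have hamax : ∀ c ∈ P₁, q c = q a₀ → c ≤ a := by
    intro c hc e
    rcases hch.total hc ha.prop.1 with h1 | h1
    · exact h1
    · exact ha.le_of_ge ⟨hc, e⟩ h1
  refine ⟨a, ha.prop.1, b, hb.prop.1, ha.prop.2, ?_, ⟨hb.prop.2.le, hb.prop.2.ne, ?_⟩, hamax⟩
  · rcases hAc (q b) (ha.prop.2 ▸ hmono hb.prop.2.le) (hmono hbb₀) with e | e
    · exact absurd (hamax b hb.prop.1 e) (not_le_of_gt hb.prop.2)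
    · exact e
  · intro z haz hzb
    have haz : a ≤ z := haz
    have hzb : z ≤ b := hzb
    have hzP : z ∈ P₁ := by
      have hci : IsChain (· ≤ ·) (insert z P₁) := by
        apply hch.insert
        intro c hc _
        rcases hch.total hc ha.prop.1 with h1 | h1
        · exact Or.inr (h1.trans haz)
        · rcases h1.eq_or_lt with e | h1
          · exact Or.inr (e ▸ haz)
          · left
            rcases hch.total hc hb.prop.1 with h2 | h2
            · exact hzb.trans (hb.le_of_le ⟨hc, h1⟩ h2)
            · exact hzb.trans h2
      have := h.2.1.2.2 (insert z P₁) (by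
        rintro w (rfl | hw)
        · exact ⟨(pp_bd h ha.prop.1).1.trans haz, hzb.trans (pp_bd h hb.prop.1).2⟩
        · exact h.2.1.1 hw) hci (Set.subset_insert _ _)
      rw [this]; exact Set.mem_insert _ _
    rcases haz.eq_or_lt with e | h1
    · exact Or.inl e.symm
    · exact Or.inr (le_antisymm hzb (hb.le_of_le ⟨hzP, h1⟩ hzb))

theorem covR_covBy {N : Type*} [Lattice N] {a b : N} (h : CovR (· ≤ ·) a b) : a ⋖ b := by
  refine ⟨lt_of_le_of_ne h.1 h.2.1, fun z h1 h2 => ?_⟩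
  rcases h.2.2 z h1.le h2.le with e | e
  · exact h1.ne' e
  · exact h2.ne e

theorem ascending_image {E : Type*} [PartialOrder E] {lab : L → L → E} {lab' : M → M → E}
    (hinf : ∀ x y : L, q (x ⊓ y) = q x ⊓ q y)
    (hcompat : ∀ x y : L, x ⋖ y → q x ⋖ q y → lab' (q x) (q y) = lab x y)
    (h : IsPolygonPair (· ≤ ·) x y P₁ P₂)
    (hasc : ChainAscending (· ≤ ·) lab (· < ·) P₁) :
    ChainAscending (· ≤ ·) lab' (· < ·) (q '' P₁) := by
  intro A B C D hA hB hC hD hAB hCD hBC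
  have hmono := q_mono_s12 hinf
  obtain ⟨a, ha, b, hb, rfl, rfl, hab, -⟩ := lift_cover hinf h hA hB hAB
  obtain ⟨c, hc, d, hd, rfl, rfl, hcd, hmax⟩ := lift_cover hinf h hC hD hCD
  have hbc : b ≤ c := by
    rcases h.2.1.2.1.total hb hc with h1 | h1
    · exact h1
    · exact hmax b hb (le_antisymm hBC (hmono h1))
  rw [hcompat a b (covR_covBy hab) (covR_covBy hAB), hcompat c d (covR_covBy hcd) (covR_covBy hCD)]
  exact hasc a b c d ha hb hc hd hab hcd hbc

theorem square_step (hsurj : Function.Surjective q)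
    (hsup : ∀ x y : L, q (x ⊔ y) = q x ⊔ q y)
    (hinf : ∀ x y : L, q (x ⊓ y) = q x ⊓ q y) {C C' : Set L} (hC : IsChain (· ≤ ·) C)
    (hs : SquareMove (· ≤ ·) C C') :
    IsChain (· ≤ ·) C' ∧ SqEquiv (· ≤ ·) (q '' C) (q '' C') := by
  obtain ⟨x, y, P₁, P₂, h, hcard, hP, hP', hd⟩ := hs
  have hC' := move_chain h hC hP hd
  refine ⟨hC', ?_⟩
  rcases polygon_image hsurj hsup hinf h with ⟨e1, e2⟩ | ⟨hp, h4⟩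
  · rw [pp_image_eq_of_collapse hP hP' hd (e1.trans e2.symm)]
    exact Relation.ReflTransGen.refl
  · apply Relation.ReflTransGen.single
    refine ⟨q x, q y, q '' P₁, q '' P₂, hp, ?_, Set.image_mono hP, Set.image_mono hP',
      Set.Subset.antisymm (diff_image_aux hinf h hC hP hd)
        (diff_image_aux hinf h.swap hC' hP' hd.symm)⟩
    refine le_antisymm ?_ h4
    rw [q_Icc hsurj hsup hinf h.1, ← hcard]
    exact Set.ncard_image_le (Set.toFinite _)

theorem sq_step (hsurj : Function.Surjective q)
    (hsup : ∀ x y : L, q (x ⊔ y) = q x ⊔ q y)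
    (hinf : ∀ x y : L, q (x ⊓ y) = q x ⊓ q y) {C C' : Set L} (hC : IsChain (· ≤ ·) C)
    (hs : SqEquiv (· ≤ ·) C C') :
    IsChain (· ≤ ·) C' ∧ SqEquiv (· ≤ ·) (q '' C) (q '' C') := by
  induction hs with
  | refl => exact ⟨hC, Relation.ReflTransGen.refl⟩
  | tail _ hm ih =>
    have := square_step hsurj hsup hinf ih.1 hm
    exact ⟨this.1, Relation.ReflTransGen.trans ih.2 this.2⟩

theorem inc_step {E : Type*} [PartialOrder E] {lab : L → L → E} {lab' : M → M → E}
    (hsurj : Function.Surjective q)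
    (hsup : ∀ x y : L, q (x ⊔ y) = q x ⊔ q y)
    (hinf : ∀ x y : L, q (x ⊓ y) = q x ⊓ q y)
    (hcompat : ∀ x y : L, x ⋖ y → q x ⋖ q y → lab' (q x) (q y) = lab x y)
    {C C' : Set L} (hC : IsChain (· ≤ ·) C)
    (hs : IncPolygonMove (· ≤ ·) lab (· < ·) C C') :
    IsChain (· ≤ ·) C' ∧ MGPre (· ≤ ·) lab' (· < ·) (q '' C) (q '' C') := by
  obtain ⟨x, y, P₁, P₂, h, hcard, hP, hP', hd, hasc⟩ := hs
  have hC' := move_chain h hC hP hd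
  refine ⟨hC', ?_⟩
  rcases polygon_image hsurj hsup hinf h with ⟨e1, e2⟩ | ⟨hp, h4⟩
  · rw [pp_image_eq_of_collapse hP hP' hd (e1.trans e2.symm)]
    exact Relation.ReflTransGen.refl
  · apply Relation.ReflTransGen.single
    have hdd := Set.Subset.antisymm (diff_image_aux hinf h hC hP hd)
        (diff_image_aux hinf h.swap hC' hP' hd.symm)
    by_cases h4' : (IccR (· ≤ ·) (q x) (q y)).ncard = 4
    · exact Or.inl (Relation.ReflTransGen.single ⟨q x, q y, q '' P₁, q '' P₂, hp, h4',
        Set.image_mono hP, Set.image_mono hP', hdd⟩)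
    · exact Or.inr ⟨q x, q y, q '' P₁, q '' P₂, hp, h4',
        Set.image_mono hP, Set.image_mono hP', hdd, ascending_image hinf hcompat h hasc⟩

theorem lift_chain (hsurj : Function.Surjective q)
    (hinf : ∀ x y : L, q (x ⊓ y) = q x ⊓ q y) (D : Set M) (hD : IsMaxChain (· ≤ ·) D) :
    ∃ C : Set L, IsMaxChain (· ≤ ·) C ∧ q '' C = D := by
  have hmono := q_mono_s12 hinf
  have hex : ∀ m : M, ∃ w : L, Minimal (fun c => q c = m) w := by
    intro m
    obtain ⟨w, hw⟩ := hsurj m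
    obtain ⟨v, -, hv⟩ := Set.Finite.exists_le_minimal
      (s := {c | q c = m}) (Set.toFinite _) (a := w) hw
    exact ⟨v, hv⟩
  choose s hs using hex
  have hsm : Monotone s := by
    intro m n hmn
    have e : q (s m ⊓ s n) = m := by
      rw [hinf, (hs m).prop, (hs n).prop, inf_eq_left.2 hmn]
    exact ((hs m).le_of_le e inf_le_left).trans inf_le_right
  have hc : IsChain (· ≤ ·) (s '' D) := by
    rintro _ ⟨a, ha, rfl⟩ _ ⟨b, hb, rfl⟩ _
    rcases hD.1.total ha hb with h1 | h1
    · exact Or.inl (hsm h1)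
    · exact Or.inr (hsm h1)
  obtain ⟨C, hsub, -, hC, hCm⟩ := exists_maxChainIn Set.univ (s '' D) (Set.subset_univ _) hc
  refine ⟨C, ⟨hC, fun K hK hCK => hCm K (Set.subset_univ _) hK hCK⟩, ?_⟩
  symm
  apply hD.2
  · rintro _ ⟨a, ha, rfl⟩ _ ⟨b, hb, rfl⟩ _
    rcases hC.total ha hb with h1 | h1
    · exact Or.inl (hmono h1)
    · exact Or.inr (hmono h1)
  · intro d hd
    exact ⟨s d, hsub ⟨d, hd, rfl⟩, (hs d).prop⟩

end Helpers

/-- Let `L` be a finite polygonal lattice with `lab` a forcing-consistent polygonal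
edge labelling valued in a finite poset `E`, and let `q : L → M` realise a
lattice congruence on `L` as a lattice quotient, with `lab'` the quotient edge
labelling (characterised by `lab' (q x) (q y) = lab x y` whenever `x ⋖ y` in
`L` and `q x ⋖ q y` in `M`).  Then the induced map `[C] ↦ [q '' C]` on
square-equivalence classes of maximal chains is an order-preserving surjection
from `(MC(L)/∼, ≼_lab)` to `(MC(M)/∼, ≼_lab')`. -/
theorem induced_map_order_preserving_surjection {L M E : Type*} [Lattice L]
    [Lattice M] [Finite L] [Finite M] [PartialOrder E] [Finite E]
    (hL : IsPolygonalLattice L) (lab : L → L → E)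
    (hfc : ForcingConsistent lab) (hpl : PolygonalLabelling lab)
    (q : L → M) (hsurj : Function.Surjective q)
    (hsup : ∀ x y : L, q (x ⊔ y) = q x ⊔ q y)
    (hinf : ∀ x y : L, q (x ⊓ y) = q x ⊓ q y)
    (lab' : M → M → E)
    (hcompat : ∀ x y : L, x ⋖ y → q x ⋖ q y → lab' (q x) (q y) = lab x y) :
    (∀ C C' : Set L, IsMaxChain (· ≤ ·) C → IsMaxChain (· ≤ ·) C' →
      MGPre (· ≤ ·) lab (· < ·) C C' →
      MGPre (· ≤ ·) lab' (· < ·) (q '' C) (q '' C')) ∧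
    (∀ D : Set M, IsMaxChain (· ≤ ·) D →
      ∃ C : Set L, IsMaxChain (· ≤ ·) C ∧ SqEquiv (· ≤ ·) (q '' C) D) := by
  constructor
  · intro C C' hC _ hpre
    have : IsChain (· ≤ ·) C' ∧ MGPre (· ≤ ·) lab' (· < ·) (q '' C) (q '' C') := by
      clear * - hC hpre hsurj hsup hinf hcompat
      induction hpre with
      | refl => exact ⟨hC.1, Relation.ReflTransGen.refl⟩
      | tail _ hm ih =>
        rcases hm with hm | hm
        · have := sq_step hsurj hsup hinf ih.1 hm
          exact ⟨this.1, Relation.ReflTransGen.tail ih.2 (Or.inl this.2)⟩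
        · have := inc_step hsurj hsup hinf hcompat ih.1 hm
          exact ⟨this.1, Relation.ReflTransGen.trans ih.2 this.2⟩
    exact this.2
  · intro D hD
    obtain ⟨C, hC, e⟩ := lift_chain hsurj hinf D hD
    exact ⟨C, hC, e ▸ Relation.ReflTransGen.refl⟩
end
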